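/- arXiv:math/0702665 — 6 statements merged into one kernel-verified Lean document; each statement's English description precedes it below -/
import Mathlib

section
/- Let d ≥ 1, m₀ ≥ 1 be integers, 0<r₀<1 and 1/(2+r₀) < δ₀ < 1 (so that (2+r₀)δ₀ > 1). For all multi-indices ν,ν̄ ∈ ℕ^d with |ν|,|ν̄| ≤ m₀ let a_{ν,ν̄} = a_{ν̄,ν} ∈ C_b^{2+r₀}(ℝ^d) be real-valued, and let a_{ν,ν̄,h} be their h-dependent regularizations by a common mollifier γ. Then there exists h₀ ∈ (0,1] such that for all h ∈ (0,h₀] and all φ ∈ C_c^∞(ℝ^d;ℂ): |Σ_{|ν|,|ν̄|≤m₀} ⟨(a_{ν,ν̄} − a_{ν,ν̄,h})·(hD)^ν φ, (hD)^{ν̄} φ⟩_{L²}| ≤ h · Σ_{|ν|≤m₀} (m₀!/(ν!·(m₀−|ν|)!)) ‖(hD)^ν φ‖²_{L²}. (This expresses the inequalities P_h^− ≤ A_h ≤ P_h^+ in the sense of quadratic forms, where P_h^± are the regularized operators with the extra term ±h(I−h²Δ)^{m₀}.) -/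
open MeasureTheory

noncomputable section

/-- Partial derivative in the `j`-th coordinate direction. -/
noncomputable def pd {ι : Type*} [Fintype ι] [DecidableEq ι] {F : Type*}
    [NormedAddCommGroup F] [NormedSpace ℝ F]
    (j : ι) (f : EuclideanSpace ℝ ι → F) : EuclideanSpace ℝ ι → F :=
  fun x => fderiv ℝ f x (EuclideanSpace.single j 1)

/-- Iterated partial derivative `∂^α` associated with the multi-index `α`. -/
noncomputable def mpd {ι : Type*} [Fintype ι] [DecidableEq ι] {F : Type*}
    [NormedAddCommGroup F] [NormedSpace ℝ F]
    (α : ι → ℕ) (f : EuclideanSpace ℝ ι → F) : EuclideanSpace ℝ ι → F :=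
  (Finset.univ : Finset ι).toList.foldr (fun j T => (pd j)^[α j] ∘ T) id f

/-- The length `|α|` of a multi-index. -/
def mdeg {ι : Type*} [Fintype ι] (α : ι → ℕ) : ℕ := ∑ j, α j

/-- `a ∈ C_b^{2+r₀}(ℝ^d)` : `a` is twice continuously differentiable, its derivatives of
order `≤ 2` are bounded, and the second order derivatives are uniformly `r₀`-Hölder. -/
def CbHolder {d : ℕ} (r₀ : ℝ) (a : EuclideanSpace ℝ (Fin d) → ℝ) : Prop :=
  ContDiff ℝ 2 a ∧
  (∀ k : ℕ, k ≤ 2 → ∃ C : ℝ, ∀ x, ‖iteratedFDeriv ℝ k a x‖ ≤ C) ∧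
  ∃ C : ℝ, ∀ x y, ‖iteratedFDeriv ℝ 2 a x - iteratedFDeriv ℝ 2 a y‖ ≤ C * ‖x - y‖ ^ r₀

/-- A mollifier `γ ∈ C_c^∞(ℝ^d)` with `∫ γ = 1` and vanishing moments of order `1 ≤ |α| ≤ 2`. -/
def IsMollifier {d : ℕ} (γ : EuclideanSpace ℝ (Fin d) → ℝ) : Prop :=
  ContDiff ℝ (⊤ : ℕ∞) γ ∧ HasCompactSupport γ ∧ (∫ x, γ x) = 1 ∧
  ∀ α : Fin d → ℕ, 1 ≤ mdeg α → mdeg α ≤ 2 → (∫ x, (∏ j, x j ^ α j) * γ x) = 0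

/-- The `h`-dependent regularization `a_h(x) = ∫ a(y) γ(h^{-δ₀}(x-y)) h^{-dδ₀} dy`. -/
noncomputable def reg {d : ℕ} (δ₀ : ℝ) (γ a : EuclideanSpace ℝ (Fin d) → ℝ) (h : ℝ) :
    EuclideanSpace ℝ (Fin d) → ℝ :=
  fun x => ∫ y, a y * γ ((h ^ (-δ₀)) • (x - y)) * h ^ (-(d : ℝ) * δ₀)

/-- The operator `(hD)^ν`, `(hD)^ν φ = (−ih)^{|ν|} ∂^ν φ`. -/
noncomputable def hDpow {d : ℕ} (h : ℝ) (ν : Fin d → ℕ)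
    (φ : EuclideanSpace ℝ (Fin d) → ℂ) : EuclideanSpace ℝ (Fin d) → ℂ :=
  fun x => (-Complex.I * (h:ℂ)) ^ (mdeg ν) * mpd ν φ x

/-- The Finset of multi-indices `ν ∈ ℕ^d` with `|ν| ≤ m₀` (encoded with components `≤ m₀`). -/
def MIdx (d m₀ : ℕ) : Finset (Fin d → Fin (m₀+1)) :=
  Finset.univ.filter fun ν => (∑ j, (ν j : ℕ)) ≤ m₀

theorem qf_mpd_prop {d : ℕ} (α : Fin d → ℕ) (φ : EuclideanSpace ℝ (Fin d) → ℂ)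
    (h1 : ContDiff ℝ (⊤ : ℕ∞) φ) (h2 : HasCompactSupport φ) :
    ContDiff ℝ (⊤ : ℕ∞) (mpd α φ) ∧ HasCompactSupport (mpd α φ) := by
  have hpd : ∀ (j : Fin d) (f : EuclideanSpace ℝ (Fin d) → ℂ),
      (ContDiff ℝ (⊤ : ℕ∞) f ∧ HasCompactSupport f) →
      (ContDiff ℝ (⊤ : ℕ∞) (pd j f) ∧ HasCompactSupport (pd j f)) := by
    intro j f hf
    refine ⟨?_, ?_⟩
    · unfold pd
      exact (hf.1.fderiv_right (m := (⊤ : ℕ∞)) (by simp)).clm_apply contDiff_const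
    · exact hf.2.fderiv_apply (𝕜 := ℝ) _
  have hit : ∀ (n : ℕ) (j : Fin d) (f : EuclideanSpace ℝ (Fin d) → ℂ),
      (ContDiff ℝ (⊤ : ℕ∞) f ∧ HasCompactSupport f) →
      (ContDiff ℝ (⊤ : ℕ∞) ((pd j)^[n] f) ∧ HasCompactSupport ((pd j)^[n] f)) := by
    intro n
    induction n with
    | zero => intro j f hf; exact hf
    | succ n ih => intro j f hf; exact ih j _ (hpd j f hf)
  unfold mpd
  generalize (Finset.univ : Finset (Fin d)).toList = l
  induction l with
  | nil => exact ⟨h1, h2⟩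
  | cons j l ih =>
    simp only [List.foldr_cons, Function.comp_apply]
    exact hit _ j _ ih

theorem qf_taylor {d : ℕ} {r₀ : ℝ} (hr₀ : 0 < r₀) {a : EuclideanSpace ℝ (Fin d) → ℝ}
    (ha : CbHolder r₀ a) :
    ∃ C : ℝ, 0 ≤ C ∧ ∀ x v, |a (x + v) - a x - fderiv ℝ a x v
      - 1 / 2 * fderiv ℝ (fderiv ℝ a) x v v| ≤ C * ‖v‖ ^ (2 + r₀) := by
  obtain ⟨h2, -, C, hC⟩ := ha
  refine ⟨|C|, abs_nonneg _, fun x v => ?_⟩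
  have hd1 : Differentiable ℝ a := h2.differentiable (by norm_num)
  have hd2 : Differentiable ℝ (fderiv ℝ a) :=
    (h2.fderiv_right (m := 1) (by norm_num)).differentiable (by norm_num)
  have hl : ∀ t : ℝ, HasDerivAt (fun t : ℝ => x + t • v) v t := fun t => by
    simpa using ((hasDerivAt_id t).smul_const v).const_add x
  have e0 : ∀ t : ℝ, HasDerivAt (fun t : ℝ => a (x + t • v)) (fderiv ℝ a (x + t • v) v) t :=
    fun t => (hd1 (x + t • v)).hasFDerivAt.comp_hasDerivAt t (hl t)
  have e1 : ∀ t : ℝ, HasDerivAt (fun t : ℝ => fderiv ℝ a (x + t • v) v)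
      (fderiv ℝ (fderiv ℝ a) (x + t • v) v v) t := fun t => by
    have := (hd2 (x + t • v)).hasFDerivAt.comp_hasDerivAt t (hl t)
    simpa using this.clm_apply (hasDerivAt_const t v)
  have bd : ∀ t : ℝ, t ∈ Set.Icc (0:ℝ) 1 → |fderiv ℝ (fderiv ℝ a) (x + t • v) v v
      - fderiv ℝ (fderiv ℝ a) x v v| ≤ |C| * ‖v‖ ^ (2 + r₀) := by
    intro t ht
    have h1 := hC (x + t • v) x
    have h3 := (iteratedFDeriv ℝ 2 a (x + t • v) - iteratedFDeriv ℝ 2 a x).le_opNorm ![v, v]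
    simp only [ContinuousMultilinearMap.sub_apply, iteratedFDeriv_two_apply, Fin.prod_univ_two,
      Matrix.cons_val_zero, Matrix.cons_val_one, Real.norm_eq_abs] at h3
    refine h3.trans ?_
    have h4 : C * ‖x + t • v - x‖ ^ r₀ ≤ |C| * ‖v‖ ^ r₀ := by
      have : ‖x + t • v - x‖ ≤ ‖v‖ := by
        rw [add_sub_cancel_left, norm_smul, Real.norm_eq_abs, abs_of_nonneg ht.1]
        exact mul_le_of_le_one_left (norm_nonneg _) ht.2
      calc C * ‖x + t • v - x‖ ^ r₀ ≤ |C| * ‖x + t • v - x‖ ^ r₀ :=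
            mul_le_mul_of_nonneg_right (le_abs_self C) (by positivity)
        _ ≤ _ := by gcongr
    rcases eq_or_ne v 0 with rfl | hv
    · simp; positivity
    · have hv' : 0 < ‖v‖ := norm_pos_iff.2 hv
      rw [Real.rpow_add hv']
      have : ‖v‖ ^ (2:ℝ) = ‖v‖ * ‖v‖ := by
        rw [show (2:ℝ) = ((2:ℕ):ℝ) by norm_num, Real.rpow_natCast]; ring
      rw [this]
      calc _ ≤ (|C| * ‖v‖ ^ r₀) * (‖v‖ * ‖v‖) :=
            mul_le_mul_of_nonneg_right (h1.trans h4) (by positivity)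
        _ = _ := by ring
  have g1 : ∀ t ∈ Set.Icc (0:ℝ) 1, |fderiv ℝ a (x + t • v) v - fderiv ℝ a x v
      - t * fderiv ℝ (fderiv ℝ a) x v v| ≤ |C| * ‖v‖ ^ (2 + r₀) := by
    intro t ht
    have := norm_image_sub_le_of_norm_deriv_le_segment' (a := (0:ℝ)) (b := 1)
      (f := fun t : ℝ => fderiv ℝ a (x + t • v) v - t * fderiv ℝ (fderiv ℝ a) x v v)
      (f' := fun t => fderiv ℝ (fderiv ℝ a) (x + t • v) v v - fderiv ℝ (fderiv ℝ a) x v v)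
      (C := |C| * ‖v‖ ^ (2 + r₀))
      (fun s _ => by
        refine (((e1 s).sub ((hasDerivAt_id s).mul_const
          (fderiv ℝ (fderiv ℝ a) x v v))).congr_deriv ?_).hasDerivWithinAt
        simp)
      (fun s hs => bd s ⟨hs.1, hs.2.le⟩) t ht
    have h5 : |C| * ‖v‖ ^ (2 + r₀) * (t - 0) ≤ |C| * ‖v‖ ^ (2 + r₀) :=
      mul_le_of_le_one_right (by positivity) (by linarith [ht.2])
    refine le_trans (le_of_eq ?_) (this.trans h5)
    rw [Real.norm_eq_abs]; congr 1; simp; ring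
  have := norm_image_sub_le_of_norm_deriv_le_segment' (a := (0:ℝ)) (b := 1)
      (f := fun t : ℝ => a (x + t • v) - t * fderiv ℝ a x v
        - t ^ 2 * (1 / 2 * fderiv ℝ (fderiv ℝ a) x v v))
      (f' := fun t => fderiv ℝ a (x + t • v) v - fderiv ℝ a x v
        - t * fderiv ℝ (fderiv ℝ a) x v v)
      (C := |C| * ‖v‖ ^ (2 + r₀))
      (fun s _ => by
        have := ((e0 s).sub ((hasDerivAt_id s).mul_const (fderiv ℝ a x v))).sub
          ((hasDerivAt_pow 2 s).mul_const (1 / 2 * fderiv ℝ (fderiv ℝ a) x v v))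
        refine (this.congr_deriv ?_).hasDerivWithinAt
        simp; ring)
      (fun s hs => g1 s ⟨hs.1, hs.2.le⟩) 1 ⟨zero_le_one, le_refl _⟩
  refine le_trans (le_of_eq ?_) (this.trans (le_of_eq (by ring)))
  rw [Real.norm_eq_abs]; congr 1; simp; ring

theorem qf_lin {d : ℕ} {γ : EuclideanSpace ℝ (Fin d) → ℝ} (hγ : IsMollifier γ)
    (L : EuclideanSpace ℝ (Fin d) →L[ℝ] ℝ) : ∫ z, L z * γ z = 0 := by
  obtain ⟨h1, h2, -, h4⟩ := hγ
  have hL : ∀ z, L z * γ z = ∑ j, L (EuclideanSpace.single j 1) * (z j * γ z) := by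
    intro z
    have : z = ∑ j, z j • EuclideanSpace.single j (1:ℝ) := by
      simpa using ((EuclideanSpace.basisFun (Fin d) ℝ).sum_repr z).symm
    conv_lhs => rw [this]
    simp only [map_sum, map_smul, smul_eq_mul, Finset.sum_mul]
    rw [← this]
    exact Finset.sum_congr rfl fun j _ => by ring
  simp_rw [hL]
  rw [integral_finset_sum]
  · refine Finset.sum_eq_zero fun j _ => ?_
    rw [integral_const_mul]
    have := h4 (Pi.single j 1) (by simp [mdeg]) (by simp [mdeg])
    have e : ∀ x : EuclideanSpace ℝ (Fin d), ∏ i, x i ^ (Pi.single j 1 : Fin d → ℕ) i = x j := by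
      intro x
      rw [Finset.prod_eq_single j] <;> simp +contextual [Pi.single_apply]
    simp_rw [e] at this
    rw [this, mul_zero]
  · intro j _
    refine Continuous.integrable_of_hasCompactSupport (by have := h1.continuous; fun_prop) ?_
    exact (h2.mul_left).mul_left

theorem qf_bilin {d : ℕ} {γ : EuclideanSpace ℝ (Fin d) → ℝ} (hγ : IsMollifier γ)
    (B : EuclideanSpace ℝ (Fin d) →L[ℝ] EuclideanSpace ℝ (Fin d) →L[ℝ] ℝ) :
    ∫ z, B z z * γ z = 0 := by
  obtain ⟨h1, h2, -, h4⟩ := hγ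
  have hL : ∀ z, B z z * γ z = ∑ i, ∑ j,
      B (EuclideanSpace.single i 1) (EuclideanSpace.single j 1) * (z i * z j * γ z) := by
    intro z
    have : z = ∑ j, z j • EuclideanSpace.single j (1:ℝ) := by
      simpa using ((EuclideanSpace.basisFun (Fin d) ℝ).sum_repr z).symm
    have e : B z z = ∑ i, ∑ j,
      B (EuclideanSpace.single i 1) (EuclideanSpace.single j 1) * (z i * z j) := by
      have e1 : ∀ L : EuclideanSpace ℝ (Fin d) →L[ℝ] ℝ,
          L z = ∑ j, z j * L (EuclideanSpace.single j 1) := fun L => by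
        conv_lhs => rw [this]
        simp only [map_sum, map_smul, smul_eq_mul]
      rw [← B.flip_apply, e1]
      refine Finset.sum_congr rfl fun i _ => ?_
      rw [B.flip_apply, e1, Finset.mul_sum]
      exact Finset.sum_congr rfl fun j _ => by ring
    rw [e]
    simp only [Finset.sum_mul, mul_assoc]
  simp_rw [hL]
  have hint : ∀ i j : Fin d, Integrable (fun z : EuclideanSpace ℝ (Fin d) =>
      B (EuclideanSpace.single i 1) (EuclideanSpace.single j 1) * (z i * z j * γ z)) := by
    intro i j
    refine Continuous.integrable_of_hasCompactSupport (by have := h1.continuous; fun_prop) ?_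
    exact (h2.mul_left).mul_left
  rw [integral_finset_sum _ fun i _ => integrable_finset_sum _ fun j _ => hint i j]
  refine Finset.sum_eq_zero fun i _ => ?_
  rw [integral_finset_sum _ fun j _ => hint i j]
  refine Finset.sum_eq_zero fun j _ => ?_
  rw [integral_const_mul]
  have := h4 (Pi.single i 1 + Pi.single j 1) (by simp [mdeg, Finset.sum_add_distrib])
    (by simp [mdeg, Finset.sum_add_distrib])
  have e : ∀ x : EuclideanSpace ℝ (Fin d),
      ∏ k, x k ^ (Pi.single i 1 + Pi.single j 1 : Fin d → ℕ) k = x i * x j := by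
    intro x
    have e' : ∀ j : Fin d, ∏ i, x i ^ (Pi.single j 1 : Fin d → ℕ) i = x j := by
      intro j
      rw [Finset.prod_eq_single j] <;> simp +contextual [Pi.single_apply]
    simp only [Pi.add_apply, pow_add, Finset.prod_mul_distrib, e']
  simp_rw [e] at this
  rw [this, mul_zero]

theorem qf_reg_eq {d : ℕ} (δ₀ : ℝ) (γ a : EuclideanSpace ℝ (Fin d) → ℝ) {h : ℝ} (hh : 0 < h)
    (x : EuclideanSpace ℝ (Fin d)) :
    reg δ₀ γ a h x = ∫ z, a (x + (-(h ^ δ₀)) • z) * γ z := by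
  unfold reg
  set c := h ^ (-(d:ℝ) * δ₀) with hc
  have hR : 0 < h ^ (-δ₀) := Real.rpow_pos_of_pos hh _
  have hRi : h ^ δ₀ * h ^ (-δ₀) = 1 := by rw [← Real.rpow_add hh]; simp
  have hcR : (h ^ (-δ₀)) ^ d = c := by
    rw [← Real.rpow_natCast, ← Real.rpow_mul hh.le, hc]; congr 1; ring
  have hcpos : 0 < c := Real.rpow_pos_of_pos hh _
  have s1 := integral_sub_left_eq_self (μ := (volume : Measure (EuclideanSpace ℝ (Fin d))))
    (fun w => a (x - w) * γ ((h ^ (-δ₀)) • w) * c) x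
  have s2 := Measure.integral_comp_smul (volume : Measure (EuclideanSpace ℝ (Fin d)))
    (fun z => a (x + (-(h ^ δ₀)) • z) * γ z * c) (h ^ (-δ₀))
  simp only [sub_sub_cancel] at s1
  rw [s1]
  have : ∀ w : EuclideanSpace ℝ (Fin d), x + (-(h ^ δ₀)) • (h ^ (-δ₀)) • w = x - w := by
    intro w
    rw [smul_smul, neg_mul, hRi]; simp [sub_eq_add_neg]
  simp only [this] at s2
  rw [s2, integral_mul_const]
  simp only [finrank_euclideanSpace, Fintype.card_fin, hcR, smul_eq_mul]
  rw [abs_of_pos (inv_pos.2 hcpos)]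
  field_simp

theorem qf_approx {d : ℕ} {r₀ δ₀ : ℝ} (hr₀ : 0 < r₀) {γ : EuclideanSpace ℝ (Fin d) → ℝ}
    (hγ : IsMollifier γ) {a : EuclideanSpace ℝ (Fin d) → ℝ} (ha : CbHolder r₀ a) :
    ∃ C : ℝ, 0 ≤ C ∧ ∀ h : ℝ, 0 < h → ∀ x,
      |a x - reg δ₀ γ a h x| ≤ C * h ^ (δ₀ * (2 + r₀)) := by
  obtain ⟨C, hC0, hC⟩ := qf_taylor hr₀ ha
  have hac : Continuous a := ha.1.continuous
  have hgc : Continuous γ := hγ.1.continuous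
  have hgs : HasCompactSupport γ := hγ.2.1
  have hint : ∀ f : EuclideanSpace ℝ (Fin d) → ℝ, Continuous f →
      Integrable (fun z => f z * γ z) := fun f hf =>
    Continuous.integrable_of_hasCompactSupport (hf.mul hgc) hgs.mul_left
  refine ⟨C * ∫ z, ‖z‖ ^ (2 + r₀) * |γ z|,
    mul_nonneg hC0 (integral_nonneg fun z => by positivity), fun h hh x => ?_⟩
  rw [qf_reg_eq δ₀ γ a hh x]
  set ε := h ^ δ₀ with hε
  have hεp : 0 < ε := Real.rpow_pos_of_pos hh _
  set L := fderiv ℝ a x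
  set B := fderiv ℝ (fderiv ℝ a) x
  have hBc : Continuous fun z => B z z := by fun_prop
  have key : ∫ z, (a (x + (-ε) • z) - a x - L ((-ε) • z) - 1 / 2 * B ((-ε) • z) ((-ε) • z)) * γ z
      = (∫ z, a (x + (-ε) • z) * γ z) - a x := by
    have e : ∀ z, (a (x + (-ε) • z) - a x - L ((-ε) • z)
        - 1 / 2 * B ((-ε) • z) ((-ε) • z)) * γ z
      = a (x + (-ε) • z) * γ z - a x * γ z - (-ε) * (L z * γ z)
        - (1 / 2 * ε ^ 2) * (B z z * γ z) := by
      intro z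
      simp only [map_smul, ContinuousLinearMap.smul_apply, smul_eq_mul]; ring
    simp_rw [e]
    have i1 := hint (fun z => a (x + (-ε) • z)) (by fun_prop)
    have i2 := hint (fun _ => a x) (by fun_prop)
    have i3 := (hint (fun z => L z) (by fun_prop)).const_mul (-ε)
    have i4 := (hint _ hBc).const_mul (1 / 2 * ε ^ 2)
    have j2 : Integrable fun z => a (x + (-ε) • z) * γ z - a x * γ z := i1.sub i2
    have j3 : Integrable fun z => a (x + (-ε) • z) * γ z - a x * γ z - (-ε) * (L z * γ z) :=
      j2.sub i3
    rw [integral_sub j3 i4, integral_sub j2 i3, integral_sub i1 i2,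
      integral_const_mul, integral_const_mul, integral_const_mul, qf_lin hγ, qf_bilin hγ, hγ.2.2.1]
    ring
  rw [abs_sub_comm, ← key, ← Real.norm_eq_abs]
  have ib : Integrable fun z : EuclideanSpace ℝ (Fin d) =>
      (C * h ^ (δ₀ * (2 + r₀))) * (‖z‖ ^ (2 + r₀) * |γ z|) := by
    refine Integrable.const_mul ?_ _
    refine Continuous.integrable_of_hasCompactSupport ?_ ?_
    · exact (continuous_norm.rpow_const fun _ => Or.inr (by positivity)).mul hgc.abs
    · exact (hgs.comp_left (g := fun t : ℝ => |t|) abs_zero).mul_left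
  refine (norm_integral_le_of_norm_le ib (Filter.Eventually.of_forall fun z => ?_)).trans ?_
  · rw [norm_mul, Real.norm_eq_abs, Real.norm_eq_abs, ← mul_assoc]
    refine mul_le_mul_of_nonneg_right ((hC x _).trans (le_of_eq ?_)) (abs_nonneg _)
    rw [norm_smul, norm_neg, Real.norm_eq_abs, abs_of_pos hεp, Real.mul_rpow hεp.le (norm_nonneg _),
      hε, ← Real.rpow_mul hh.le]
    ring
  · rw [integral_const_mul]; exact le_of_eq (by ring)

theorem qf_coef {d m₀ : ℕ} {ν : Fin d → Fin (m₀+1)} (hν : ν ∈ MIdx d m₀) :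
    (1:ℝ) ≤ (m₀.factorial : ℝ) /
      ((∏ j, ((ν j : ℕ).factorial : ℝ)) * ((m₀ - ∑ j, (ν j : ℕ)).factorial : ℝ)) := by
  have hs : ∑ j, (ν j : ℕ) ≤ m₀ := by simpa [MIdx] using hν
  have h1 : ((∏ j, (ν j : ℕ).factorial) * (m₀ - ∑ j, (ν j : ℕ)).factorial) ∣ m₀.factorial :=
    (mul_dvd_mul_right (Nat.prod_factorial_dvd_factorial_sum _ _) _).trans
      (Nat.factorial_mul_factorial_dvd_factorial hs)
  have h2 := Nat.le_of_dvd (Nat.factorial_pos _) h1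
  rw [one_le_div]
  · exact_mod_cast h2
  · exact mul_pos (Finset.prod_pos fun j _ => by exact_mod_cast Nat.factorial_pos _)
      (by exact_mod_cast Nat.factorial_pos _)

/-- Comparison of the quadratic forms of the operator with coefficients `a_{ν,ν̄}` and of its
regularization: for `h₀` small enough and `h ∈ (0,h₀]`,
`|Σ ⟨(a_{ν,ν̄} − a_{ν,ν̄,h})(hD)^ν φ, (hD)^ν̄ φ⟩| ≤ h Σ (m₀!/(ν!(m₀−|ν|)!)) ‖(hD)^ν φ‖²`,
which expresses `P_h^- ≤ A_h ≤ P_h^+` in the sense of quadratic forms. -/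
theorem quadratic_form_comparison {d m₀ : ℕ} (hd : 1 ≤ d) (hm : 1 ≤ m₀) {r₀ δ₀ : ℝ}
    (hr₀ : 0 < r₀) (hr₁ : r₀ < 1) (hδl : 1 / (2 + r₀) < δ₀) (hδu : δ₀ < 1)
    (γ : EuclideanSpace ℝ (Fin d) → ℝ) (hγ : IsMollifier γ)
    (a : (Fin d → Fin (m₀+1)) → (Fin d → Fin (m₀+1)) → EuclideanSpace ℝ (Fin d) → ℝ)
    (hsym : ∀ ν ν', a ν ν' = a ν' ν)
    (hreg : ∀ ν ν', CbHolder r₀ (a ν ν')) :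
    ∃ h₀ ∈ Set.Ioc (0:ℝ) 1, ∀ h ∈ Set.Ioc (0:ℝ) h₀,
      ∀ φ : EuclideanSpace ℝ (Fin d) → ℂ, ContDiff ℝ (⊤ : ℕ∞) φ → HasCompactSupport φ →
        ‖∑ ν ∈ MIdx d m₀, ∑ ν' ∈ MIdx d m₀,
            ∫ x, ((a ν ν' x - reg δ₀ γ (a ν ν') h x : ℝ) : ℂ)
              * hDpow h (fun j => (ν j : ℕ)) φ x
              * (starRingEnd ℂ) (hDpow h (fun j => (ν' j : ℕ)) φ x)‖
          ≤ h * ∑ ν ∈ MIdx d m₀,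
              ((m₀.factorial : ℝ) /
                ((∏ j, ((ν j : ℕ).factorial : ℝ)) * ((m₀ - ∑ j, (ν j : ℕ)).factorial : ℝ)))
                * ∫ x, ‖hDpow h (fun j => (ν j : ℕ)) φ x‖ ^ 2 := by
  choose C hC0 hC using fun ν ν' => qf_approx (δ₀ := δ₀) hr₀ hγ (hreg ν ν')
  set K : ℝ := ∑ ν, ∑ ν', C ν ν' with hK
  have hCK : ∀ ν ν', C ν ν' ≤ K := fun ν ν' =>
    (Finset.single_le_sum (f := fun ν' => C ν ν') (fun i _ => hC0 ν i) (Finset.mem_univ ν')).trans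
      (Finset.single_le_sum (f := fun ν => ∑ ν', C ν ν')
        (fun i _ => Finset.sum_nonneg fun j _ => hC0 i j) (Finset.mem_univ ν))
  set N : ℝ := ((MIdx d m₀).card : ℝ) with hN
  have hs : 0 < δ₀ * (2 + r₀) - 1 := by
    rw [div_lt_iff₀ (by linarith)] at hδl; linarith
  have hlim : Filter.Tendsto (fun h : ℝ => K * N * h ^ (δ₀ * (2 + r₀) - 1)) (nhds 0) (nhds 0) := by
    have := (Real.continuousAt_rpow_const 0 (δ₀ * (2 + r₀) - 1) (Or.inr hs.le)).tendsto.const_mul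
      (K * N)
    simpa [Real.zero_rpow hs.ne'] using this
  obtain ⟨ε, hε, hball⟩ := Metric.eventually_nhds_iff.1 (hlim.eventually (gt_mem_nhds zero_lt_one))
  refine ⟨min 1 (ε / 2), ⟨by positivity, min_le_left _ _⟩, ?_⟩
  rintro h ⟨hh, hhle⟩ φ hφ hφs
  have hsmall : K * N * h ^ (δ₀ * (2 + r₀)) ≤ h := by
    have h1 := hball (y := h) (by
      rw [Real.dist_eq, sub_zero, abs_of_pos hh]; linarith [hhle.trans (min_le_right _ _)])
    have h2 : h ^ (δ₀ * (2 + r₀)) = h ^ (δ₀ * (2 + r₀) - 1) * h := by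
      rw [Real.rpow_sub_one hh.ne']; field_simp
    rw [h2, ← mul_assoc]
    exact mul_le_of_le_one_left hh.le h1.le
  set M : ℝ := K * h ^ (δ₀ * (2 + r₀)) with hM
  have hM0 : 0 ≤ M := mul_nonneg
    (Finset.sum_nonneg fun i _ => Finset.sum_nonneg fun j _ => hC0 i j) (by positivity)
  set u : (Fin d → Fin (m₀+1)) → EuclideanSpace ℝ (Fin d) → ℂ :=
    fun ν => hDpow h (fun j => (ν j : ℕ)) φ with hu
  have hui : ∀ ν, Integrable fun x => ‖u ν x‖ ^ 2 := by
    intro ν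
    obtain ⟨p1, p2⟩ := qf_mpd_prop (fun j => (ν j : ℕ)) φ hφ hφs
    have c : Continuous (u ν) := continuous_const.mul p1.continuous
    have s : HasCompactSupport (u ν) := p2.mul_left
    exact Continuous.integrable_of_hasCompactSupport (by fun_prop)
      (s.comp_left (g := fun t : ℂ => ‖t‖ ^ 2) (by simp))
  set I : (Fin d → Fin (m₀+1)) → ℝ := fun ν => ∫ x, ‖u ν x‖ ^ 2 with hI
  have hI0 : ∀ ν, 0 ≤ I ν := fun ν => integral_nonneg fun x => by positivity
  have hterm : ∀ ν ν', ‖∫ x, ((a ν ν' x - reg δ₀ γ (a ν ν') h x : ℝ) : ℂ) * u ν x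
      * (starRingEnd ℂ) (u ν' x)‖ ≤ M * (I ν / 2 + I ν' / 2) := by
    intro ν ν'
    have ib : Integrable fun x => M * (‖u ν x‖ ^ 2 / 2 + ‖u ν' x‖ ^ 2 / 2) :=
      (((hui ν).div_const 2).add ((hui ν').div_const 2)).const_mul M
    refine (norm_integral_le_of_norm_le ib (Filter.Eventually.of_forall fun x => ?_)).trans
      (le_of_eq ?_)
    · rw [norm_mul, norm_mul, RCLike.norm_conj, Complex.norm_real, Real.norm_eq_abs, mul_assoc]
      have b1 : |a ν ν' x - reg δ₀ γ (a ν ν') h x| ≤ M :=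
        (hC ν ν' h hh x).trans (mul_le_mul_of_nonneg_right (hCK ν ν') (by positivity))
      exact mul_le_mul b1 (by nlinarith [sq_nonneg (‖u ν x‖ - ‖u ν' x‖)]) (by positivity) hM0
    · rw [integral_const_mul, integral_add ((hui ν).div_const 2) ((hui ν').div_const 2),
        integral_div, integral_div]
  calc _ ≤ ∑ ν ∈ MIdx d m₀, ∑ ν' ∈ MIdx d m₀, M * (I ν / 2 + I ν' / 2) :=
        (norm_sum_le _ _).trans (Finset.sum_le_sum fun ν _ =>
          (norm_sum_le _ _).trans (Finset.sum_le_sum fun ν' _ => hterm ν ν'))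
    _ = M * N * ∑ ν ∈ MIdx d m₀, I ν := by
        simp only [← Finset.mul_sum, Finset.sum_add_distrib, Finset.sum_const, nsmul_eq_mul,
          ← Finset.sum_div]
        rw [hN]; ring
    _ ≤ h * ∑ ν ∈ MIdx d m₀, I ν :=
        mul_le_mul_of_nonneg_right (le_trans (le_of_eq (by rw [hM]; ring)) hsmall)
          (Finset.sum_nonneg fun ν _ => hI0 ν)
    _ ≤ _ := by
        refine mul_le_mul_of_nonneg_left (Finset.sum_le_sum fun ν hν => ?_) hh.le
        exact le_mul_of_one_le_left (hI0 ν) (qf_coef hν)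

end
end

section
/- Let 0 < δ₀ < 1/2, h₀ ∈ (0,1], Γ̄₀ ⊂ ℝ^{2d} compact, and let a₀ : ℝ^{2d} → ℝ be C¹. Let (p̂_h)_{h∈(0,h₀]} be a family of real-valued C^∞ functions on ℝ^{2d} such that: (i) for every multi-index α with |α| ≥ 2 there is C_α with sup_{ℝ^{2d}} |∂^α p̂_h| ≤ C_α h^{−δ₀(|α|−2)} for all h; and (ii) for every ε′ > 0 there is h_{ε′} ∈ (0,h₀] with sup_{Γ̄₀} |∇p̂_h − ∇a₀| ≤ ε′ h^{δ₀} whenever h ≤ h_{ε′}. Let (l_h)_{h∈(0,h₀]} be a family of C^∞ functions on ℝ^{2d} with supp l_h ⊂ Γ̄₀ and, for all multi-indices α,β ∈ ℕ^d, |∂^α_ξ ∂^β_x l_h(x,ξ)| ≤ C_{α,β} h^{−|β|δ₀}. Then for every C̄ > 1 there exist c̄ > 0, h₁ ∈ (0,h₀] and families (l̂_h), (ľ_h) of C^∞ functions (h ∈ (0,h₁]) such that: l_h = l̂_h + ľ_h; supp l̂_h ⊆ supp l_h ∩ {v : |∇a₀(v)| ≤ C̄h^{δ₀}}; supp ľ_h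 ⊆ Γ̄₀ ∩ {v : |∇a₀(v)| > c̄h^{δ₀}}; and each of the two families b_h ∈ {l̂_h, ľ_h} satisfies, for all α,β ∈ ℕ^d with constants independent of h: |∂^α_ξ ∂^β_x b_h(v)| ≤ C_{α,β} h^{−(|α|+|β|)δ₀} for all v ∈ ℝ^{2d}, and |∂^α_ξ ∂^β_x b_h(v)| ≤ C_{α,β} h^{−|β|δ₀} for all v with |∇a₀(v)| > C̄h^{δ₀}. -/
open MeasureTheory

noncomputable section

/-- The phase space `ℝ^{2d} = ℝ^d_x × ℝ^d_ξ`, with `Sum.inl` the `x`-coordinates and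
`Sum.inr` the `ξ`-coordinates. -/
abbrev E2 (d : ℕ) := EuclideanSpace ℝ (Fin d ⊕ Fin d)

section aux
variable {ι : Type*} [Fintype ι] [DecidableEq ι] {F : Type*}
    [NormedAddCommGroup F] [NormedSpace ℝ F]

def pdL (L : List ι) (f : EuclideanSpace ℝ ι → F) : EuclideanSpace ℝ ι → F :=
  L.foldr pd f

lemma pd_contDiff {f : EuclideanSpace ℝ ι → F} (hf : ContDiff ℝ (⊤ : ℕ∞) f) (j : ι) :
    ContDiff ℝ (⊤ : ℕ∞) (pd j f) := by
  unfold pd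
  exact (hf.fderiv_right (m := (⊤ : ℕ∞)) (by simp)).clm_apply contDiff_const

lemma pdL_contDiff {f : EuclideanSpace ℝ ι → F} (hf : ContDiff ℝ (⊤ : ℕ∞) f) (L : List ι) :
    ContDiff ℝ (⊤ : ℕ∞) (pdL L f) := by
  induction L with
  | nil => exact hf
  | cons j L ih => exact pd_contDiff ih j

lemma pd_comm {f : EuclideanSpace ℝ ι → F} (hf : ContDiff ℝ (⊤ : ℕ∞) f) (i j : ι) :
    pd i (pd j f) = pd j (pd i f) := by
  have hd : Differentiable ℝ (fderiv ℝ f) :=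
    (hf.fderiv_right (m := (⊤ : ℕ∞)) (by simp)).differentiable (by simp)
  funext x
  have key : ∀ i j : ι, pd i (pd j f) x =
      fderiv ℝ (fderiv ℝ f) x (EuclideanSpace.single i 1) (EuclideanSpace.single j 1) := by
    intro i j
    have : HasFDerivAt (pd j f)
        ((fderiv ℝ (fderiv ℝ f) x).flip (EuclideanSpace.single j 1)) x :=
      (ContinuousLinearMap.apply ℝ F
        (EuclideanSpace.single j (1 : ℝ) : EuclideanSpace ℝ ι)).hasFDerivAt.comp x
        (hd x).hasFDerivAt
    simp only [pd] at this ⊢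
    rw [this.fderiv]; rfl
  rw [key, key]
  have hs : IsSymmSndFDerivAt ℝ f x := hf.contDiffAt.isSymmSndFDerivAt
    (by simp only [minSmoothness_of_isRCLikeNormedField]; exact WithTop.coe_le_coe.2 le_top)
  exact hs _ _

lemma pdL_perm {f : EuclideanSpace ℝ ι → F} (hf : ContDiff ℝ (⊤ : ℕ∞) f) {L L' : List ι}
    (h : L.Perm L') : pdL L f = pdL L' f := by
  induction h with
  | nil => rfl
  | cons j _ ih => simp only [pdL, List.foldr_cons] at ih ⊢; rw [ih]
  | swap i j L => exact pd_comm (pdL_contDiff hf L) _ _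
  | trans _ _ h1 h2 => exact h1.trans h2

lemma iteratedFDeriv_eq_pdL {f : EuclideanSpace ℝ ι → F} (hf : ContDiff ℝ (⊤ : ℕ∞) f)
    (n : ℕ) (J : Fin n → ι) (v : EuclideanSpace ℝ ι) :
    iteratedFDeriv ℝ n f v (fun i => EuclideanSpace.single (J i) (1 : ℝ)) =
      pdL (List.ofFn J) f v := by
  induction n generalizing v with
  | zero => simp [pdL]
  | succ n ih =>
    rw [iteratedFDeriv_succ_apply_left, List.ofFn_succ]
    have hd : DifferentiableAt ℝ (iteratedFDeriv ℝ n f) v :=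
      hf.differentiable_iteratedFDeriv (m := n) (by exact_mod_cast WithTop.coe_lt_top n) v
    have hc : pdL (List.ofFn fun i : Fin n => J i.succ) f = fun y =>
        iteratedFDeriv ℝ n f y (fun i => EuclideanSpace.single (J i.succ) (1 : ℝ)) := by
      funext y; rw [ih]
    change _ = pd (J 0) (pdL (List.ofFn fun i : Fin n => J i.succ) f) v
    rw [hc]
    have h2 := (ContinuousMultilinearMap.apply ℝ (fun _ : Fin n => EuclideanSpace ℝ ι) F
      (fun i => EuclideanSpace.single (J i.succ) (1 : ℝ))).hasFDerivAt.comp v hd.hasFDerivAt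
    unfold pd
    have h3 := h2.fderiv
    simp only [Function.comp_def, ContinuousMultilinearMap.apply_apply] at h3
    rw [h3]; rfl

lemma mpd_eq_pdL (α : ι → ℕ) (f : EuclideanSpace ℝ ι → F) :
    mpd α f = pdL ((Finset.univ : Finset ι).toList.flatMap fun j => List.replicate (α j) j) f := by
  unfold mpd pdL
  induction (Finset.univ : Finset ι).toList with
  | nil => rfl
  | cons j L ih =>
    simp only [List.foldr_cons, Function.comp_apply, List.flatMap_cons, List.foldr_append, ih]
    generalize List.foldr pd f _ = g
    generalize α j = m
    induction m with
    | zero => rfl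
    | succ m ihm => rw [Function.iterate_succ_apply', ihm]; rfl

lemma mpd_list_count (α : ι → ℕ) (i : ι) :
    ((Finset.univ : Finset ι).toList.flatMap fun j => List.replicate (α j) j).count i = α i := by
  rw [List.count_flatMap]
  simp only [Function.comp_def, List.count_replicate]
  rw [Finset.sum_map_toList]
  simp

lemma mpd_list_length (α : ι → ℕ) :
    ((Finset.univ : Finset ι).toList.flatMap fun j => List.replicate (α j) j).length = mdeg α := by
  rw [List.length_flatMap]
  simp only [List.length_replicate]
  rw [Finset.sum_map_toList]; rfl

lemma exists_mpd_eq (α : ι → ℕ) : ∃ J : Fin (mdeg α) → ι,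
    ∀ f : EuclideanSpace ℝ ι → F, ContDiff ℝ (⊤ : ℕ∞) f → ∀ v, mpd α f v =
      iteratedFDeriv ℝ (mdeg α) f v (fun i => EuclideanSpace.single (J i) (1 : ℝ)) := by
  rw [← mpd_list_length α]
  refine ⟨List.get _, fun f hf v => ?_⟩
  rw [iteratedFDeriv_eq_pdL hf, List.ofFn_get, mpd_eq_pdL]

lemma iteratedFDeriv_eq_mpd (n : ℕ) (J : Fin n → ι) :
    ∃ α : ι → ℕ, mdeg α = n ∧ ∀ f : EuclideanSpace ℝ ι → F, ContDiff ℝ (⊤ : ℕ∞) f → ∀ v,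
      iteratedFDeriv ℝ n f v (fun i => EuclideanSpace.single (J i) (1 : ℝ)) = mpd α f v := by
  have hp : ((Finset.univ : Finset ι).toList.flatMap fun j =>
      List.replicate ((List.ofFn J).count j) j).Perm (List.ofFn J) := by
    rw [List.perm_iff_count]; intro i; rw [mpd_list_count]
  refine ⟨fun j => (List.ofFn J).count j, ?_, fun f hf v => ?_⟩
  · rw [← mpd_list_length, hp.length_eq, List.length_ofFn]
  · rw [iteratedFDeriv_eq_pdL hf, mpd_eq_pdL, pdL_perm hf hp]

lemma norm_mpd_le {f : EuclideanSpace ℝ ι → F} (hf : ContDiff ℝ (⊤ : ℕ∞) f) (α : ι → ℕ)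
    (v : EuclideanSpace ℝ ι) : ‖mpd α f v‖ ≤ ‖iteratedFDeriv ℝ (mdeg α) f v‖ := by
  obtain ⟨J, hJ⟩ := exists_mpd_eq (F := F) α
  rw [hJ f hf]
  refine (ContinuousMultilinearMap.le_opNorm _ _).trans ?_
  simp

lemma norm_multilinear_le {n : ℕ}
    (M : ContinuousMultilinearMap ℝ (fun _ : Fin n => EuclideanSpace ℝ ι) F) :
    ‖M‖ ≤ ∑ J : Fin n → ι, ‖M (fun i => EuclideanSpace.single (J i) (1 : ℝ))‖ := by
  refine ContinuousMultilinearMap.opNorm_le_bound (by positivity) fun m => ?_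
  have hm : m = fun i => ∑ j : ι, (m i j) • EuclideanSpace.single j (1 : ℝ) := by
    funext i
    ext k
    simp [Finset.sum_apply, Pi.single_apply]
  conv_lhs => rw [hm]
  rw [M.map_sum, Finset.sum_mul]
  refine (norm_sum_le _ _).trans (Finset.sum_le_sum fun J _ => ?_)
  rw [M.map_smul_univ, norm_smul, mul_comm, norm_prod]
  gcongr with i
  exact PiLp.norm_apply_le (m i) (J i)

/-- uniform control of the full derivative by partial derivatives -/
lemma exists_iteratedFDeriv_bound (n : ℕ) (f : ℝ → EuclideanSpace ℝ ι → F) (S : Set ℝ)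
    (hf : ∀ h ∈ S, ContDiff ℝ (⊤ : ℕ∞) (f h)) (w : ℝ → ℝ) (hw : ∀ h ∈ S, 0 ≤ w h)
    (hb : ∀ α : ι → ℕ, mdeg α = n → ∃ C : ℝ, ∀ h ∈ S, ∀ v, ‖mpd α (f h) v‖ ≤ C * w h) :
    ∃ C : ℝ, 0 ≤ C ∧ ∀ h ∈ S, ∀ v, ‖iteratedFDeriv ℝ n (f h) v‖ ≤ C * w h := by
  choose α hα1 hα2 using iteratedFDeriv_eq_mpd (ι := ι) (F := F) n
  choose C hC using fun J => hb (α J) (hα1 J)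
  refine ⟨∑ J, |C J|, by positivity, fun h hh v => ?_⟩
  refine (norm_multilinear_le _).trans ?_
  rw [Finset.sum_mul]
  refine Finset.sum_le_sum fun J _ => ?_
  rw [hα2 J _ (hf h hh)]
  exact (hC J h hh v).trans (mul_le_mul_of_nonneg_right (le_abs_self _) (hw h hh))

/-- composition with a compactly supported function -/
lemma comp_bound {E G : Type*} [NormedAddCommGroup E] [NormedSpace ℝ E]
    [NormedAddCommGroup G] [NormedSpace ℝ G]
    (χ : G → ℝ) (hχ : ContDiff ℝ (⊤ : ℕ∞) χ) (hc : HasCompactSupport χ)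
    (g : ℝ → E → G) (S : Set ℝ) (hg : ∀ h ∈ S, ContDiff ℝ (⊤ : ℕ∞) (g h))
    (s : ℝ → ℝ) (hs : ∀ h ∈ S, 0 ≤ s h)
    (hb : ∀ n : ℕ, ∃ C : ℝ, 0 ≤ C ∧ ∀ h ∈ S, ∀ v,
      ‖iteratedFDeriv ℝ (n + 1) (g h) v‖ ≤ C * s h ^ (n + 1)) (n : ℕ) :
    ∃ C : ℝ, 0 ≤ C ∧ ∀ h ∈ S, ∀ v, ‖iteratedFDeriv ℝ n (χ ∘ g h) v‖ ≤ C * s h ^ n := by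
  choose C hC0 hC using hb
  have hK : ∀ i : ℕ, ∃ K : ℝ, ∀ w, ‖iteratedFDeriv ℝ i χ w‖ ≤ K := fun i =>
    (hc.iteratedFDeriv i).exists_bound_of_continuous
      (hχ.continuous_iteratedFDeriv (by exact_mod_cast le_top))
  choose K hK using hK
  have hK0 : ∀ i, 0 ≤ K i := fun i => (norm_nonneg _).trans (hK i 0)
  set A : ℝ := ∑ i ∈ Finset.range (n + 1), K i with hA
  set B : ℝ := 1 + ∑ i ∈ Finset.range (n + 1), C i with hB
  have hA0 : 0 ≤ A := Finset.sum_nonneg fun i _ => hK0 i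
  have hB1 : 1 ≤ B := by
    have := Finset.sum_nonneg (s := Finset.range (n + 1)) fun i _ => hC0 i
    linarith
  refine ⟨n.factorial * A * B ^ n, by positivity, fun h hh v => ?_⟩
  have := norm_iteratedFDeriv_comp_le (n := n) (N := (⊤ : ℕ∞)) hχ (hg h hh)
    (by exact_mod_cast le_top) v (C := A) (D := B * s h) ?_ ?_
  · rw [mul_pow, ← mul_assoc] at this; exact this
  · intro i hi
    refine (hK i _).trans ?_
    exact Finset.single_le_sum (f := K) (fun i _ => hK0 i) (Finset.mem_range.2 (by omega))
  · intro i hi1 hi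
    obtain ⟨j, rfl⟩ : ∃ j, i = j + 1 := ⟨i - 1, by omega⟩
    refine (hC j h hh v).trans ?_
    rw [mul_pow]
    refine mul_le_mul_of_nonneg_right ?_ (pow_nonneg (hs h hh) _)
    have h1 : C j ≤ B := by
      have := Finset.single_le_sum (f := C) (s := Finset.range (n + 1)) (fun i _ => hC0 i)
        (Finset.mem_range.2 (show j < n + 1 by omega))
      linarith
    exact h1.trans (le_self_pow₀ hB1 (by omega))

lemma smul_bound {E F : Type*} [NormedAddCommGroup E] [NormedSpace ℝ E]
    [NormedAddCommGroup F] [NormedSpace ℝ F]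
    (f : ℝ → E → ℝ) (g : ℝ → E → F) (S : Set ℝ)
    (hf : ∀ h ∈ S, ContDiff ℝ (⊤ : ℕ∞) (f h)) (hg : ∀ h ∈ S, ContDiff ℝ (⊤ : ℕ∞) (g h))
    (s : ℝ → ℝ) (hs : ∀ h ∈ S, 0 ≤ s h)
    (hbf : ∀ n : ℕ, ∃ C : ℝ, 0 ≤ C ∧ ∀ h ∈ S, ∀ v, ‖iteratedFDeriv ℝ n (f h) v‖ ≤ C * s h ^ n)
    (hbg : ∀ n : ℕ, ∃ C : ℝ, 0 ≤ C ∧ ∀ h ∈ S, ∀ v, ‖iteratedFDeriv ℝ n (g h) v‖ ≤ C * s h ^ n)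
    (n : ℕ) :
    ∃ C : ℝ, 0 ≤ C ∧ ∀ h ∈ S, ∀ v,
      ‖iteratedFDeriv ℝ n (fun y => f h y • g h y) v‖ ≤ C * s h ^ n := by
  choose C hC0 hC using hbf
  choose C' hC0' hC' using hbg
  refine ⟨∑ i ∈ Finset.range (n + 1), (n.choose i : ℝ) * C i * C' (n - i),
    Finset.sum_nonneg fun i _ => mul_nonneg (mul_nonneg (by positivity) (hC0 i)) (hC0' _),
    fun h hh v => ?_⟩
  refine (norm_iteratedFDeriv_smul_le (N := (⊤ : ℕ∞)) (hf h hh) (hg h hh) v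
    (by exact_mod_cast le_top)).trans ?_
  rw [Finset.sum_mul]
  refine Finset.sum_le_sum fun i hi => ?_
  have hi' : i ≤ n := by have := Finset.mem_range.1 hi; omega
  have h0 := hs h hh
  have h1 := hC0 i
  calc _ ≤ (n.choose i : ℝ) * (C i * s h ^ i) * (C' (n - i) * s h ^ (n - i)) := by
        gcongr
        · exact hC i h hh v
        · exact hC' _ h hh v
    _ = (n.choose i : ℝ) * C i * C' (n - i) * (s h ^ i * s h ^ (n - i)) := by ring
    _ = _ := by rw [← pow_add, Nat.add_sub_cancel' hi']

lemma norm_gradient_eq {E : Type*} [NormedAddCommGroup E] [InnerProductSpace ℝ E]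
    [CompleteSpace E] (f : E → ℝ) (v : E) : ‖gradient f v‖ = ‖fderiv ℝ f v‖ := by
  unfold gradient; rw [LinearIsometryEquiv.norm_map]

lemma norm_gradient_sub_eq {E : Type*} [NormedAddCommGroup E] [InnerProductSpace ℝ E]
    [CompleteSpace E] (f g : E → ℝ) (v : E) :
    ‖gradient f v - gradient g v‖ = ‖fderiv ℝ f v - fderiv ℝ g v‖ := by
  unfold gradient; rw [← map_sub, LinearIsometryEquiv.norm_map]

end aux

/-- Decomposition `l = l̂ + ľ` of a symbol into a part supported near the critical points of
`a₀` (where `|∇a₀| ≤ C̄h^{δ₀}`) and a part supported where `|∇a₀| > c̄h^{δ₀}`, with the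
corresponding symbol estimates (Lemma 2.4). -/
theorem symbol_decomposition {d : ℕ} {δ₀ h₀ : ℝ} (hδ0 : 0 < δ₀) (hδ1 : δ₀ < 1/2)
    (hh₀ : 0 < h₀) (hh₀1 : h₀ ≤ 1)
    (Γ₀ : Set (E2 d)) (hΓ : IsCompact Γ₀)
    (a₀ : E2 d → ℝ) (ha₀ : ContDiff ℝ 1 a₀)
    (p : ℝ → E2 d → ℝ)
    (hpsm : ∀ h ∈ Set.Ioc (0:ℝ) h₀, ContDiff ℝ (⊤ : ℕ∞) (p h))
    -- (i) : `|∂^α p̂_h| ≤ C_α h^{−δ₀(|α|−2)}` for `|α| ≥ 2`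
    (hpi : ∀ α : (Fin d ⊕ Fin d) → ℕ, 2 ≤ mdeg α → ∃ C : ℝ,
      ∀ h ∈ Set.Ioc (0:ℝ) h₀, ∀ v : E2 d,
        |mpd α (p h) v| ≤ C * h ^ (-δ₀ * ((mdeg α : ℝ) - 2)))
    -- (ii) : `sup_{Γ̄₀} |∇p̂_h − ∇a₀| ≤ ε′ h^{δ₀}` for `h` small
    (hpii : ∀ ε' : ℝ, 0 < ε' → ∃ hε ∈ Set.Ioc (0:ℝ) h₀, ∀ h ∈ Set.Ioc (0:ℝ) hε,
      ∀ v ∈ Γ₀, ‖gradient (p h) v - gradient a₀ v‖ ≤ ε' * h ^ δ₀)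
    (l : ℝ → E2 d → ℂ)
    (hlsm : ∀ h ∈ Set.Ioc (0:ℝ) h₀, ContDiff ℝ (⊤ : ℕ∞) (l h))
    (hlsupp : ∀ h ∈ Set.Ioc (0:ℝ) h₀, tsupport (l h) ⊆ Γ₀)
    (hlb : ∀ α β : Fin d → ℕ, ∃ C : ℝ, ∀ h ∈ Set.Ioc (0:ℝ) h₀, ∀ v : E2 d,
      ‖mpd (Sum.elim β α) (l h) v‖ ≤ C * h ^ (-(mdeg β : ℝ) * δ₀)) :
    ∀ Cb : ℝ, 1 < Cb →
      ∃ cb : ℝ, 0 < cb ∧ ∃ h₁ ∈ Set.Ioc (0:ℝ) h₀, ∃ lhat lcheck : ℝ → E2 d → ℂ,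
        (∀ h ∈ Set.Ioc (0:ℝ) h₁,
          ContDiff ℝ (⊤ : ℕ∞) (lhat h) ∧ ContDiff ℝ (⊤ : ℕ∞) (lcheck h) ∧
          (∀ v, l h v = lhat h v + lcheck h v) ∧
          tsupport (lhat h) ⊆ tsupport (l h) ∩ {v | ‖gradient a₀ v‖ ≤ Cb * h ^ δ₀} ∧
          tsupport (lcheck h) ⊆ Γ₀ ∩ {v | cb * h ^ δ₀ < ‖gradient a₀ v‖}) ∧
        (∀ b ∈ ([lhat, lcheck] : List (ℝ → E2 d → ℂ)), ∀ α β : Fin d → ℕ, ∃ C : ℝ,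
          ∀ h ∈ Set.Ioc (0:ℝ) h₁, ∀ v : E2 d,
            ‖mpd (Sum.elim β α) (b h) v‖ ≤ C * h ^ (-((mdeg α + mdeg β : ℕ) : ℝ) * δ₀) ∧
            (Cb * h ^ δ₀ < ‖gradient a₀ v‖ →
              ‖mpd (Sum.elim β α) (b h) v‖ ≤ C * h ^ (-(mdeg β : ℝ) * δ₀))) := by
  intro Cb hCb
  set s : ℝ → ℝ := fun h => h ^ (-δ₀) with hs
  have hspow : ∀ h : ℝ, 0 < h → ∀ n : ℕ, h ^ (-(n : ℝ) * δ₀) = s h ^ n := by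
    intro h hh n
    simp only [hs]
    rw [← Real.rpow_natCast, ← Real.rpow_mul hh.le]; congr 1; ring
  have hs1 : ∀ h ∈ Set.Ioc (0:ℝ) h₀, 1 ≤ s h := fun h hh =>
    Real.one_le_rpow_of_pos_of_le_one_of_nonpos hh.1 (hh.2.trans hh₀1) (by linarith)
  have hs0 : ∀ h ∈ Set.Ioc (0:ℝ) h₀, 0 ≤ s h := fun h hh => zero_le_one.trans (hs1 h hh)
  -- bounds for the full derivatives of `l`
  have hl : ∀ n : ℕ, ∃ C : ℝ, 0 ≤ C ∧ ∀ h ∈ Set.Ioc (0:ℝ) h₀, ∀ v,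
      ‖iteratedFDeriv ℝ n (l h) v‖ ≤ C * s h ^ n := by
    intro n
    refine exists_iteratedFDeriv_bound n l _ hlsm (fun h => s h ^ n)
      (fun h hh => pow_nonneg (hs0 h hh) n) fun γ hγ => ?_
    obtain ⟨C, hC⟩ := hlb (fun i => γ (Sum.inr i)) (fun i => γ (Sum.inl i))
    have hγe : Sum.elim (fun i => γ (Sum.inl i)) (fun i => γ (Sum.inr i)) = γ := by
      funext i; cases i <;> rfl
    have hle : mdeg (fun i => γ (Sum.inl i)) ≤ n := by
      rw [← hγ]; simp only [mdeg, Fintype.sum_sum_type]; omega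
    refine ⟨|C|, fun h hh v => ?_⟩
    have := hC h hh v
    rw [hγe, hspow h hh.1] at this
    refine this.trans (mul_le_mul (le_abs_self _) (pow_le_pow_right₀ (hs1 h hh) hle)
      (pow_nonneg (hs0 h hh) _) (abs_nonneg _))
  -- the rescaled differential of `p`
  set G : ℝ → E2 d → (E2 d →L[ℝ] ℝ) := fun h v => s h • fderiv ℝ (p h) v with hG
  have hfsm : ∀ h ∈ Set.Ioc (0:ℝ) h₀, ContDiff ℝ (⊤ : ℕ∞) (fderiv ℝ (p h)) := fun h hh =>
    (hpsm h hh).fderiv_right (by simp)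
  have hGsm : ∀ h ∈ Set.Ioc (0:ℝ) h₀, ContDiff ℝ (⊤ : ℕ∞) (G h) := fun h hh =>
    (hfsm h hh).const_smul (s h)
  have hGb : ∀ n : ℕ, ∃ C : ℝ, 0 ≤ C ∧ ∀ h ∈ Set.Ioc (0:ℝ) h₀, ∀ v,
      ‖iteratedFDeriv ℝ (n + 1) (G h) v‖ ≤ C * s h ^ (n + 1) := by
    intro n
    obtain ⟨C, hC0, hC⟩ := exists_iteratedFDeriv_bound (n + 2) p _ hpsm (fun h => s h ^ n)
      (fun h hh => pow_nonneg (hs0 h hh) n) (by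
        intro γ hγ
        obtain ⟨C, hC⟩ := hpi γ (by omega)
        refine ⟨C, fun h hh v => ?_⟩
        have := hC h hh v
        rw [hγ] at this
        rw [← hspow h hh.1, Real.norm_eq_abs]
        convert this using 3
        push_cast; ring)
    refine ⟨C, hC0, fun h hh v => ?_⟩
    simp only [hG]
    rw [iteratedFDeriv_const_smul_apply'
      ((hfsm h hh).contDiffAt.of_le (by exact_mod_cast le_top)), norm_smul,
      norm_iteratedFDeriv_fderiv, Real.norm_of_nonneg (hs0 h hh), pow_succ]
    have := mul_le_mul_of_nonneg_left (hC h hh v) (hs0 h hh)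
    linarith
  -- the cutoff
  let χ : ContDiffBump (0 : E2 d →L[ℝ] ℝ) := ⟨1/2, 1, by norm_num, by norm_num⟩
  have hχsm : ContDiff ℝ (⊤ : ℕ∞) (χ : (E2 d →L[ℝ] ℝ) → ℝ) := χ.contDiff
  set lh : ℝ → E2 d → ℂ := fun h v => (χ ∘ G h) v • l h v with hlh
  have hχGsm : ∀ h ∈ Set.Ioc (0:ℝ) h₀, ContDiff ℝ (⊤ : ℕ∞) (χ ∘ G h) := fun h hh =>
    hχsm.comp (hGsm h hh)
  have hlhsm : ∀ h ∈ Set.Ioc (0:ℝ) h₀, ContDiff ℝ (⊤ : ℕ∞) (lh h) := fun h hh =>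
    (hχGsm h hh).smul (hlsm h hh)
  have hlhb := smul_bound (fun h => χ ∘ G h) l (Set.Ioc (0:ℝ) h₀) hχGsm hlsm s hs0
    (comp_bound χ hχsm χ.hasCompactSupport G _ hGsm s hs0 hGb) hl
  set lc : ℝ → E2 d → ℂ := fun h => l h - lh h with hlc
  obtain ⟨h₁, hh₁, hclose⟩ := hpii (min (1/4) (Cb - 1)) (lt_min (by norm_num) (by linarith))
  have hsub : ∀ h ∈ Set.Ioc (0:ℝ) h₁, h ∈ Set.Ioc (0:ℝ) h₀ := fun h hh =>
    ⟨hh.1, hh.2.trans hh₁.2⟩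
  have hGn : ∀ h ∈ Set.Ioc (0:ℝ) h₀, ∀ v, ‖fderiv ℝ (p h) v‖ = ‖G h v‖ * h ^ δ₀ := by
    intro h hh v
    have : s h * h ^ δ₀ = 1 := by
      simp only [hs]; rw [← Real.rpow_add hh.1]; simp
    simp only [hG]
    rw [norm_smul, Real.norm_of_nonneg (hs0 h hh), mul_right_comm, this, one_mul]
  have hcl : ∀ h ∈ Set.Ioc (0:ℝ) h₁, ∀ v ∈ Γ₀,
      |‖G h v‖ * h ^ δ₀ - ‖gradient a₀ v‖| ≤ min (1/4) (Cb - 1) * h ^ δ₀ := by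
    intro h hh v hv
    have := hclose h hh v hv
    rw [norm_gradient_sub_eq] at this
    rw [← hGn h (hsub h hh), norm_gradient_eq]
    exact (abs_norm_sub_norm_le _ _).trans this
  have hlhsupp : ∀ h ∈ Set.Ioc (0:ℝ) h₁, tsupport (lh h) ⊆
      tsupport (l h) ∩ {v | ‖gradient a₀ v‖ ≤ Cb * h ^ δ₀} := by
    intro h hh v hv
    have hh' := hsub h hh
    have hvl : v ∈ tsupport (l h) := tsupport_smul_subset_right (χ ∘ G h) (l h) hv
    have hcont : Continuous fun v => ‖G h v‖ := (hGsm h hh').continuous.norm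
    have hvG : v ∈ {v | ‖G h v‖ ≤ 1} := by
      refine closure_minimal ?_ (isClosed_le hcont continuous_const) hv
      intro w hw
      by_contra hcon
      simp only [Set.mem_setOf_eq, not_le] at hcon
      apply hw
      have : χ (G h w) = 0 := χ.zero_of_le_dist (by rw [dist_zero_right]; exact hcon.le)
      simp [hlh, this]
    refine ⟨hvl, ?_⟩
    have h1 := abs_le.1 (hcl h hh v (hlsupp h hh' hvl))
    have h2 : (0:ℝ) < h ^ δ₀ := Real.rpow_pos_of_pos hh.1 _
    have h3 := mul_le_mul_of_nonneg_right (min_le_right (1/4) (Cb - 1)) h2.le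
    have h4 := mul_le_mul_of_nonneg_right (show ‖G h v‖ ≤ 1 from hvG) h2.le
    simp only [Set.mem_setOf_eq]
    linarith [h1.1]
  have hlcsupp : ∀ h ∈ Set.Ioc (0:ℝ) h₁, tsupport (lc h) ⊆
      Γ₀ ∩ {v | 1/8 * h ^ δ₀ < ‖gradient a₀ v‖} := by
    intro h hh v hv
    have hh' := hsub h hh
    have hvl : v ∈ tsupport (l h) := by
      refine closure_mono ?_ hv
      intro w hw hw0
      apply hw
      simp [hlc, hlh, hw0]
    have hcont : Continuous fun v => ‖G h v‖ := (hGsm h hh').continuous.norm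
    have hvG : v ∈ {v | 1/2 ≤ ‖G h v‖} := by
      refine closure_minimal ?_ (isClosed_le continuous_const hcont) hv
      intro w hw
      by_contra hcon
      simp only [Set.mem_setOf_eq, not_le] at hcon
      apply hw
      have : χ (G h w) = 1 := χ.one_of_mem_closedBall (by
        rw [Metric.mem_closedBall, dist_zero_right]; exact hcon.le)
      simp [hlc, hlh, this]
    have hvΓ := hlsupp h hh' hvl
    refine ⟨hvΓ, ?_⟩
    have h1 := abs_le.1 (hcl h hh v hvΓ)
    have h2 : (0:ℝ) < h ^ δ₀ := Real.rpow_pos_of_pos hh.1 _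
    have h3 := mul_le_mul_of_nonneg_right (min_le_left (1/4) (Cb - 1)) h2.le
    have h4 := mul_le_mul_of_nonneg_right (show 1/2 ≤ ‖G h v‖ from hvG) h2.le
    simp only [Set.mem_setOf_eq]
    linarith [h1.2]
  have hlcsm : ∀ h ∈ Set.Ioc (0:ℝ) h₀, ContDiff ℝ (⊤ : ℕ∞) (lc h) := fun h hh =>
    (hlsm h hh).sub (hlhsm h hh)
  have hmdeg : ∀ α β : Fin d → ℕ, mdeg (Sum.elim β α) = mdeg α + mdeg β := by
    intro α β
    simp only [mdeg, Fintype.sum_sum_type, Sum.elim_inl, Sum.elim_inr]; omega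
  -- key estimates for `lh`
  have hA : ∀ α β : Fin d → ℕ, ∃ C : ℝ, 0 ≤ C ∧ ∀ h ∈ Set.Ioc (0:ℝ) h₁, ∀ v : E2 d,
      ‖mpd (Sum.elim β α) (lh h) v‖ ≤ C * s h ^ (mdeg α + mdeg β) := by
    intro α β
    obtain ⟨C, hC0, hC⟩ := hlhb (mdeg α + mdeg β)
    refine ⟨C, hC0, fun h hh v => ?_⟩
    refine (norm_mpd_le (hlhsm h (hsub h hh)) _ v).trans ?_
    rw [hmdeg]
    exact hC h (hsub h hh) v
  have hB : ∀ α β : Fin d → ℕ, ∀ h ∈ Set.Ioc (0:ℝ) h₁, ∀ v : E2 d,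
      Cb * h ^ δ₀ < ‖gradient a₀ v‖ → mpd (Sum.elim β α) (lh h) v = 0 := by
    intro α β h hh v hv
    obtain ⟨J, hJ⟩ := exists_mpd_eq (F := ℂ) (Sum.elim β α)
    rw [hJ _ (hlhsm h (hsub h hh))]
    have : iteratedFDeriv ℝ (mdeg (Sum.elim β α)) (lh h) v = 0 := by
      by_contra hne
      have := (hlhsupp h hh (support_iteratedFDeriv_subset _ hne)).2
      simp only [Set.mem_setOf_eq] at this
      linarith
    rw [this]; rfl
  have hD : ∀ α β : Fin d → ℕ, ∀ h ∈ Set.Ioc (0:ℝ) h₁, ∀ v : E2 d,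
      mpd (Sum.elim β α) (lc h) v =
        mpd (Sum.elim β α) (l h) v - mpd (Sum.elim β α) (lh h) v := by
    intro α β h hh v
    have hh' := hsub h hh
    obtain ⟨J, hJ⟩ := exists_mpd_eq (F := ℂ) (Sum.elim β α)
    rw [hJ _ (hlhsm h hh'), hJ _ (hlsm h hh'), hJ _ (hlcsm h hh')]
    simp only [hlc]
    rw [iteratedFDeriv_sub_apply ((hlsm h hh').contDiffAt.of_le (by exact_mod_cast le_top))
      ((hlhsm h hh').contDiffAt.of_le (by exact_mod_cast le_top))]
    rfl
  refine ⟨1/8, by norm_num, h₁, hh₁, lh, lc, fun h hh => ⟨hlhsm h (hsub h hh),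
    hlcsm h (hsub h hh), fun v => by simp [hlc], hlhsupp h hh, hlcsupp h hh⟩, ?_⟩
  intro b hb α β
  obtain ⟨C, hC0, hC⟩ := hA α β
  obtain ⟨C', hC'⟩ := hlb α β
  have hb' : b = lh ∨ b = lc := by simpa using hb
  refine ⟨C + |C'|, fun h hh v => ?_⟩
  have hh' := hsub h hh
  rw [hspow h hh.1, hspow h hh.1]
  have hl1 : ‖mpd (Sum.elim β α) (l h) v‖ ≤ |C'| * s h ^ mdeg β := by
    have := hC' h hh' v
    rw [hspow h hh.1] at this
    exact this.trans (mul_le_mul_of_nonneg_right (le_abs_self _) (pow_nonneg (hs0 h hh') _))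
  have hpm : s h ^ mdeg β ≤ s h ^ (mdeg α + mdeg β) :=
    pow_le_pow_right₀ (hs1 h hh') (by omega)
  have hp0 : 0 ≤ s h ^ mdeg β := pow_nonneg (hs0 h hh') _
  have hl2 : ‖mpd (Sum.elim β α) (l h) v‖ ≤ |C'| * s h ^ (mdeg α + mdeg β) :=
    hl1.trans (mul_le_mul_of_nonneg_left hpm (abs_nonneg _))
  have hc1 := hC h hh v
  have e1 : 0 ≤ |C'| * s h ^ (mdeg α + mdeg β) := (norm_nonneg _).trans hl2
  have e2 : 0 ≤ |C'| * s h ^ mdeg β := (norm_nonneg _).trans hl1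
  have e3 : 0 ≤ C * s h ^ mdeg β := mul_nonneg hC0 hp0
  rw [add_mul, add_mul]
  rcases hb' with rfl | rfl
  · refine ⟨by linarith, fun hv => ?_⟩
    rw [hB α β h hh v hv, norm_zero]; linarith
  · rw [hD α β h hh v]
    refine ⟨(norm_sub_le _ _).trans (by linarith), fun hv => ?_⟩
    rw [hB α β h hh v hv, sub_zero]; linarith

end
end

section
/- Let d ≥ 1, let J : ℝ^{2d} → ℝ^{2d} be the standard symplectic matrix, J(x,ξ) = (ξ, −x), and let M > 0. Then there exists C₂ > 0 depending only on M and d such that: for every twice continuously differentiable p : ℝ^{2d} → ℝ whose Hessian satisfies ‖d²p(w)‖ ≤ M for all w ∈ ℝ^{2d}, every v ∈ ℝ^{2d}, and every differentiable curve θ : [−1,1] → ℝ^{2d} with θ(0) = v and θ′(t) = J∇p(θ(t)) for all t, one has |θ(t) − v − t·J∇p(v)| ≤ C₂ t² |∇p(v)| for all t ∈ [−1,1]. -/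
open MeasureTheory

noncomputable section

/-- The standard symplectic matrix `J(x,ξ) = (ξ,−x)` on `ℝ^{2d}`. -/
noncomputable def Jmap (d : ℕ) : E2 d → E2 d :=
  fun v => (EuclideanSpace.equiv (Fin d ⊕ Fin d) ℝ).symm
    (Sum.elim (fun j => v (Sum.inr j)) (fun j => - v (Sum.inl j)))

theorem Jmap_sub (d : ℕ) (a b : E2 d) : Jmap d a - Jmap d b = Jmap d (a - b) := by
  ext i
  rcases i with i | i <;> simp [Jmap]
  ring

theorem norm_Jmap (d : ℕ) (a : E2 d) : ‖Jmap d a‖ = ‖a‖ := by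
  rw [EuclideanSpace.norm_eq, EuclideanSpace.norm_eq]
  congr 1
  simp [Jmap, Fintype.sum_sum_type, add_comm]

theorem flow_aux {E : Type*} [NormedAddCommGroup E] [NormedSpace ℝ E] (M : ℝ) (hM : 0 < M)
    (F : E → E) (hF : ∀ x y, ‖F x - F y‖ ≤ M * ‖x - y‖) (v : E) (θ : ℝ → E) (h0 : θ 0 = v)
    (hθ : ∀ t ∈ Set.Icc (0:ℝ) 1, HasDerivAt θ (F (θ t)) t) (t : ℝ) (ht : t ∈ Set.Icc (0:ℝ) 1) :
    ‖θ t - v - t • F v‖ ≤ M * Real.exp M * t ^ 2 * ‖F v‖ := by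
  have h1 : ∀ s ∈ Set.Icc (0:ℝ) 1, ‖θ s - v‖ ≤ s * Real.exp M * ‖F v‖ := by
    intro s hs
    have h := norm_le_gronwallBound_of_norm_deriv_right_le (f := fun s => θ s - v)
      (f' := fun s => F (θ s)) (δ := 0) (K := M) (ε := ‖F v‖) (a := 0) (b := 1)
      (fun x hx => ((hθ x hx).sub_const v).continuousAt.continuousWithinAt)
      (fun x hx => ((hθ x ⟨hx.1, hx.2.le⟩).sub_const v).hasDerivWithinAt)
      (by simp [h0]) (by
        intro x _
        have := norm_add_le (F (θ x) - F v) (F v)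
        rw [sub_add_cancel] at this
        linarith [hF (θ x) v]) s hs
    refine h.trans ?_
    rw [gronwallBound_of_K_ne_0 hM.ne']
    simp only [zero_mul, zero_add, sub_zero]
    have e1 : Real.exp (M * s) - 1 ≤ M * s * Real.exp (M * s) := by
      have h2 := Real.add_one_le_exp (-(M * s))
      have h3 : Real.exp (-(M * s)) * Real.exp (M * s) = 1 := by
        rw [← Real.exp_add]; simp
      nlinarith [Real.exp_pos (M * s)]
    have e2 : Real.exp (M * s) ≤ Real.exp M := Real.exp_le_exp.2 (by nlinarith [hs.2])
    have e3 : Real.exp (M * s) - 1 ≤ M * s * Real.exp M :=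
      e1.trans (mul_le_mul_of_nonneg_left e2 (mul_nonneg hM.le hs.1))
    calc ‖F v‖ / M * (Real.exp (M * s) - 1) ≤ ‖F v‖ / M * (M * s * Real.exp M) :=
          mul_le_mul_of_nonneg_left e3 (by positivity)
      _ = s * Real.exp M * ‖F v‖ := by field_simp
  have hsub : ∀ s ∈ Set.Icc (0:ℝ) t, s ∈ Set.Icc (0:ℝ) 1 := fun s hs => ⟨hs.1, hs.2.trans ht.2⟩
  have h := norm_image_sub_le_of_norm_deriv_le_segment' (f := fun s => θ s - v - s • F v)
    (f' := fun s => F (θ s) - F v) (a := 0) (b := t) (C := M * (t * Real.exp M * ‖F v‖))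
    (fun s hs => by
      have := ((hθ s (hsub s hs)).sub_const v).sub ((hasDerivAt_id s).smul_const (F v))
      simpa using! this.hasDerivWithinAt)
    (fun s hs => by
      refine (hF _ _).trans (mul_le_mul_of_nonneg_left ?_ hM.le)
      refine (h1 s (hsub s ⟨hs.1, hs.2.le⟩)).trans ?_
      have := hs.2.le
      gcongr) t ⟨ht.1, le_rfl⟩
  simp only [h0, sub_self, zero_smul, sub_zero] at h
  refine h.trans (le_of_eq ?_)
  ring

theorem gradient_lip (d : ℕ) (M : ℝ) (p : E2 d → ℝ) (hp : ContDiff ℝ 2 p)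
    (hb : ∀ w : E2 d, ‖iteratedFDeriv ℝ 2 p w‖ ≤ M) (x y : E2 d) :
    ‖gradient p x - gradient p y‖ ≤ M * ‖x - y‖ := by
  have hd : Differentiable ℝ (fderiv ℝ p) :=
    (hp.fderiv_right (m := 1) (by norm_num)).differentiable (by norm_num)
  have hb' : ∀ w, ‖fderiv ℝ (fderiv ℝ p) w‖ ≤ M := by
    intro w
    have h := hb w
    rw [← norm_iteratedFDeriv_fderiv (n := 1), ← norm_iteratedFDeriv_fderiv (n := 0),
      norm_iteratedFDeriv_zero] at h
    exact h
  unfold gradient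
  rw [← map_sub, LinearIsometryEquiv.norm_map]
  exact convex_univ.norm_image_sub_le_of_norm_fderiv_le (fun z _ => hd z) (fun z _ => hb' z)
    (Set.mem_univ y) (Set.mem_univ x)

/-- Estimate (5.9): a Hamiltonian trajectory satisfies
`|θ(t) − v − tJ∇p(v)| ≤ C₂ t² |∇p(v)|`, with `C₂` depending only on the bound `M`
for the Hessian of `p` (and on `d`). -/
theorem flow_linearization_bound {d : ℕ} (hd : 1 ≤ d) (M : ℝ) (hM : 0 < M) :
    ∃ C₂ : ℝ, 0 < C₂ ∧
      ∀ p : E2 d → ℝ, ContDiff ℝ 2 p →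
        (∀ w : E2 d, ‖iteratedFDeriv ℝ 2 p w‖ ≤ M) →
        ∀ v : E2 d, ∀ θ : ℝ → E2 d, θ 0 = v →
          (∀ t ∈ Set.Icc (-1:ℝ) 1, HasDerivAt θ (Jmap d (gradient p (θ t))) t) →
          ∀ t ∈ Set.Icc (-1:ℝ) 1,
            ‖θ t - v - t • Jmap d (gradient p v)‖ ≤ C₂ * t ^ 2 * ‖gradient p v‖ := by
  refine ⟨M * Real.exp M, by positivity, ?_⟩
  intro p hp hb v θ h0 hθ t ht
  have hF : ∀ x y, ‖Jmap d (gradient p x) - Jmap d (gradient p y)‖ ≤ M * ‖x - y‖ := by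
    intro x y
    rw [Jmap_sub, norm_Jmap]
    exact gradient_lip d M p hp hb x y
  rcases le_total 0 t with h | h
  · have := flow_aux M hM (fun x => Jmap d (gradient p x)) hF v θ h0
      (fun s hs => hθ s ⟨by linarith [hs.1], hs.2⟩) t ⟨h, ht.2⟩
    simpa only [norm_Jmap] using this
  · have := flow_aux M hM (fun x => -Jmap d (gradient p x))
      (fun x y => by rw [← neg_sub', norm_neg]; exact hF x y) v (fun s => θ (-s)) (by simpa using h0)
      (fun s hs => by
        have h1 := hθ (-s) ⟨by linarith [hs.2], by linarith [hs.1]⟩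
        simpa using! h1.scomp s (hasDerivAt_neg s)) (-t) ⟨by linarith, by linarith [ht.1]⟩
    simpa only [norm_Jmap, norm_neg, neg_neg, smul_neg, neg_smul, neg_sq] using this

end
end

section
/- Let d ≥ 2 and let M be a real symmetric (2d)×(2d) matrix of rank ≥ 2. Then there exist indices j₁, j₂ ∈ {1,…,2d} such that the rows M_{j₁} and M_{j₂} of M are linearly independent, and there exist linearly independent vectors e₁, e₂, e₃ ∈ ℝ^{2d} such that: e₃ belongs to the subspace V = {0}×ℝ^d, e₁ ∉ V, e₂ ∉ V, and ⟨e_k, M_{j_k}⟩ > 0 for k = 1,2. -/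
open Matrix in
lemma exists_pos_ne {n : Type*} [Fintype n] (u p : n → ℝ) (hu : u ≠ 0) (hp : p ≠ 0) :
    ∃ e : n → ℝ, 0 < e ⬝ᵥ u ∧ e ⬝ᵥ p ≠ 0 := by
  have pos : ∀ w : n → ℝ, w ≠ 0 → 0 < w ⬝ᵥ w := by
    intro w hw
    have h0 : 0 ≤ w ⬝ᵥ w := Finset.sum_nonneg fun i _ => mul_self_nonneg _
    exact lt_of_le_of_ne h0 fun h => hw (dotProduct_self_eq_zero.1 h.symm)
  by_cases h : u ⬝ᵥ p = 0
  · refine ⟨u + p, ?_, ?_⟩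
    · rw [add_dotProduct, dotProduct_comm p u, h, add_zero]; exact pos u hu
    · rw [add_dotProduct, h, zero_add]; exact (pos p hp).ne'
  · exact ⟨u, pos u hu, h⟩

lemma exists_rows {n : Type*} [Fintype n] (M : Matrix n n ℝ) (hrank : 2 ≤ M.rank) :
    ∃ j₁ j₂, LinearIndependent ℝ ![M j₁, M j₂] := by
  by_contra! hc
  have hne : ∃ j, M j ≠ 0 := by
    by_contra! h
    have : M = 0 := funext h
    subst this
    simp at hrank
  obtain ⟨j, hj⟩ := hne
  have hle : Submodule.span ℝ (Set.range M.row) ≤ Submodule.span ℝ {M j} := by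
    rw [Submodule.span_le]
    rintro _ ⟨k, rfl⟩
    have := hc j k
    rw [LinearIndependent.pair_iff' hj] at this
    push Not at this
    exact Submodule.mem_span_singleton.2 this
  have h1 := Submodule.finrank_mono hle
  rw [finrank_span_singleton hj, ← Matrix.rank_eq_finrank_span_row] at h1
  omega


/-- If `M` is a real symmetric `2d × 2d` matrix (indexed by `Fin d ⊕ Fin d`) of rank `≥ 2`
and `d ≥ 2`, then there are two linearly independent rows `M_{j₁}, M_{j₂}` and linearly
independent vectors `e₁, e₂, e₃` with `e₃ ∈ V = {0}×ℝ^d`, `e₁, e₂ ∉ V` and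
`⟨e_k, M_{j_k}⟩ > 0` for `k = 1,2`. -/
theorem symmetric_matrix_rank_two_vectors {d : ℕ} (hd : 2 ≤ d)
    (M : Matrix (Fin d ⊕ Fin d) (Fin d ⊕ Fin d) ℝ)
    (hsym : M.IsSymm) (hrank : 2 ≤ M.rank) :
    ∃ j₁ j₂ : Fin d ⊕ Fin d, LinearIndependent ℝ ![M j₁, M j₂] ∧
      ∃ e₁ e₂ e₃ : (Fin d ⊕ Fin d) → ℝ, LinearIndependent ℝ ![e₁, e₂, e₃] ∧
        (∀ j : Fin d, e₃ (Sum.inl j) = 0) ∧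
        ¬ (∀ j : Fin d, e₁ (Sum.inl j) = 0) ∧
        ¬ (∀ j : Fin d, e₂ (Sum.inl j) = 0) ∧
        0 < ∑ i, e₁ i * M j₁ i ∧ 0 < ∑ i, e₂ i * M j₂ i := by
  obtain ⟨j₁, j₂, hj⟩ := exists_rows M hrank
  refine ⟨j₁, j₂, hj, ?_⟩
  have hu : M j₁ ≠ 0 := hj.ne_zero 0
  have hv : M j₂ ≠ 0 := hj.ne_zero 1
  let a : Fin d := ⟨0, by omega⟩
  let b : Fin d := ⟨1, by omega⟩
  have hab : a ≠ b := by simp [a, b]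
  obtain ⟨e₁, h1, h1'⟩ := exists_pos_ne (M j₁) (Pi.single (Sum.inl a) 1) hu (by simp)
  rw [dotProduct_single, mul_one] at h1'
  obtain ⟨e₂, h2, h2'⟩ := exists_pos_ne (M j₂)
    (Pi.single (Sum.inl b) (e₁ (Sum.inl a)) - Pi.single (Sum.inl a) (e₁ (Sum.inl b))) hv (by
      intro h
      have := congrFun h (Sum.inl b)
      simp [hab.symm] at this
      exact h1' this)
  rw [dotProduct_sub, dotProduct_single, dotProduct_single] at h2'
  refine ⟨e₁, e₂, Pi.single (Sum.inr a) 1, ?_, by simp, fun h => h1' (h a), ?_, h1, h2⟩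
  · rw [Fintype.linearIndependent_iff]
    intro g hg
    simp only [Fin.sum_univ_three, Matrix.cons_val_zero, Matrix.cons_val_one,
      Matrix.cons_val] at hg
    have ha := congrFun hg (Sum.inl a)
    have hb := congrFun hg (Sum.inl b)
    have hr := congrFun hg (Sum.inr a)
    simp at ha hb hr
    have g1 : g 1 = 0 := by
      have : g 1 * (e₂ (Sum.inl b) * e₁ (Sum.inl a) - e₂ (Sum.inl a) * e₁ (Sum.inl b)) = 0 := by
        linear_combination e₁ (Sum.inl a) * hb - e₁ (Sum.inl b) * ha
      exact (mul_eq_zero.1 this).resolve_right h2'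
    have g0 : g 0 = 0 := by
      simp [g1] at ha
      exact ha.resolve_right h1'
    have g2 : g 2 = 0 := by simpa [g0, g1] using hr
    intro i
    fin_cases i
    exacts [g0, g1, g2]
  · intro h
    exact h2' (by rw [h a, h b]; ring)
end

section
/- For every integer m ≥ 1 there exists a constant C_m > 0 such that: for every polynomial F : ℝ → ℝ of degree ≤ m whose m-th derivative satisfies |F^{(m)}(0)| ≥ 1, and every ε > 0, the Lebesgue measure of the set {s ∈ ℝ : |F(s)| < ε} is at most C_m ε^{1/m}. The constant C_m depends only on m (in particular it is uniform over all such polynomials). -/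
open MeasureTheory

lemma aux_prod (s : Multiset ℂ) (r : ℝ) (hr : 0 ≤ r) (x : ℂ) (h : ∀ z ∈ s, r ≤ ‖x - z‖) :
    r ^ s.card ≤ ‖((s.map (fun z => Polynomial.X - Polynomial.C z)).prod).eval x‖ := by
  induction s using Multiset.induction_on with
  | empty => simp
  | cons a s ih =>
    have h1 := ih (fun z hz => h z (Multiset.mem_cons_of_mem hz))
    have h2 := h a (Multiset.mem_cons_self a s)
    simp only [Multiset.map_cons, Multiset.prod_cons, Polynomial.eval_mul, norm_mul,
      Multiset.card_cons, pow_succ', Polynomial.eval_sub, Polynomial.eval_X, Polynomial.eval_C]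
    exact mul_le_mul h2 h1 (by positivity) (by positivity)

/-- Lemma 6.5: for every `m ≥ 1` there is `C_m > 0` such that for every real polynomial `F`
of degree `≤ m` with `|F^{(m)}(0)| ≥ 1` and every `ε > 0`, the Lebesgue measure of
`{s : |F(s)| < ε}` is at most `C_m ε^{1/m}`. -/
theorem polynomial_sublevel_measure (m : ℕ) (hm : 1 ≤ m) :
    ∃ C : ℝ, 0 < C ∧ ∀ F : Polynomial ℝ, F.natDegree ≤ m →
      1 ≤ |(Polynomial.derivative^[m] F).eval 0| →
      ∀ ε : ℝ, 0 < ε →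
        volume {s : ℝ | |F.eval s| < ε} ≤ ENNReal.ofReal (C * ε ^ ((1:ℝ) / m)) := by
  have hm0 : (0:ℝ) < m := by exact_mod_cast hm
  have hf0 : (0:ℝ) < (m.factorial : ℝ) := by exact_mod_cast m.factorial_pos
  refine ⟨m * (2 * (m.factorial : ℝ) ^ ((1:ℝ) / m)), by positivity, ?_⟩
  intro F hF hd ε hε
  have hc : (Polynomial.derivative^[m] F).eval 0 = m.factorial * F.coeff m := by
    rw [← Polynomial.coeff_zero_eq_eval_zero, Polynomial.coeff_iterate_derivative]
    simp [Nat.descFactorial_self]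
  rw [hc, abs_mul, abs_of_pos hf0] at hd
  have hne : F.coeff m ≠ 0 := by
    intro h; rw [h] at hd; norm_num at hd
  have hdeg : F.natDegree = m := le_antisymm hF (Polynomial.le_natDegree_of_ne_zero hne)
  set r : ℝ := (m.factorial : ℝ) ^ ((1:ℝ) / m) * ε ^ ((1:ℝ) / m) with hr
  have hr0 : 0 ≤ r := by positivity
  have hrm : r ^ m = m.factorial * ε := by
    rw [hr, mul_pow, one_div, Real.rpow_inv_natCast_pow hf0.le (by omega),
      Real.rpow_inv_natCast_pow hε.le (by omega)]
  set G : Polynomial ℂ := F.map (algebraMap ℝ ℂ) with hG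
  have hsp : G.Splits := IsAlgClosed.splits G
  have hcard : G.roots.card = m := by
    rw [← hsp.natDegree_eq_card_roots, hG, Polynomial.natDegree_map, hdeg]
  have hlc : ‖G.leadingCoeff‖ = |F.coeff m| := by
    rw [hG, Polynomial.leadingCoeff_map, Polynomial.leadingCoeff, hdeg]
    simp
  have hsub : {s : ℝ | |F.eval s| < ε} ⊆ ⋃ z ∈ G.roots.toFinset, Metric.closedBall z.re r := by
    intro s hs
    simp only [Set.mem_setOf_eq] at hs
    by_contra hcon
    simp only [Set.mem_iUnion, not_exists, Multiset.mem_toFinset, Metric.mem_closedBall,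
      not_le, Real.dist_eq] at hcon
    have h1 := aux_prod G.roots r hr0 (s : ℂ) (fun z hz => by
      refine (hcon z hz).le.trans ?_
      simpa using Complex.abs_re_le_norm ((s:ℂ) - z))
    have h2 : G.eval (s:ℂ) = ((F.eval s : ℝ) : ℂ) := by
      rw [hG]; exact Polynomial.eval_map_algebraMap F (s:ℂ) |>.trans (by
        simpa using Polynomial.aeval_algebraMap_apply ℂ s F)
    have h3 : |F.eval s| = |F.coeff m| *
        ‖((G.roots.map (fun z => Polynomial.X - Polynomial.C z)).prod).eval (s:ℂ)‖ := by
      have h4 := congrArg (fun p => ‖Polynomial.eval (s:ℂ) p‖) hsp.eq_prod_roots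
      simp only [Polynomial.eval_mul, norm_mul, Polynomial.eval_C, hlc, h2] at h4
      rw [← h4]; simp
    rw [hcard, hrm] at h1
    have h5 := mul_le_mul_of_nonneg_left h1 (abs_nonneg (F.coeff m))
    rw [← h3] at h5
    nlinarith
  calc volume {s : ℝ | |F.eval s| < ε}
      ≤ volume (⋃ z ∈ G.roots.toFinset, Metric.closedBall z.re r) := measure_mono hsub
    _ ≤ ∑ z ∈ G.roots.toFinset, volume (Metric.closedBall z.re r) :=
        measure_biUnion_finset_le _ _
    _ = G.roots.toFinset.card * ENNReal.ofReal (2 * r) := by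
        simp [Real.volume_closedBall]
    _ ≤ m * ENNReal.ofReal (2 * r) := by
        gcongr
        exact (Multiset.toFinset_card_le _).trans hcard.le
    _ = ENNReal.ofReal (m * (2 * (m.factorial : ℝ) ^ ((1:ℝ) / m)) * ε ^ ((1:ℝ) / m)) := by
        rw [← ENNReal.ofReal_natCast m, ← ENNReal.ofReal_mul hm0.le, hr]
        congr 1; ring
end

section
/- Let n ≥ 1, let K ⊂ ℝ^n be a measurable set of finite Lebesgue measure, let a : ℝ^n → ℝ be measurable, and fix E ∈ ℝ, C ≥ 1, ε ∈ (0,1) and an integer N ≥ 2. Then there exists a constant c > 0 depending only on N and C such that for all h ∈ (0,1]: ∫_K (1 + |a(v) − E|/(Ch))^{−N} dv ≤ c · ( h^{Nε} · vol(K) + sup_{E′ ∈ [E − h^{1−ε}, E + h^{1−ε}]} vol{ v ∈ K : |a(v) − E′| ≤ Ch } ). -/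
open MeasureTheory

/-- The discretization-into-slabs estimate: the integral over `K` of
`(1 + |a(v)−E|/(Ch))^{−N}` is bounded by
`c (h^{Nε} vol(K) + sup_{E′∈[E−h^{1−ε}, E+h^{1−ε}]} vol{v ∈ K : |a(v)−E′| ≤ Ch})`,
with `c` depending only on `N` and `C` (and the dimension `n`). -/
theorem slab_discretization_estimate {n : ℕ} (hn : 1 ≤ n)
    (N : ℕ) (hN : 2 ≤ N) (C : ℝ) (hC : 1 ≤ C) :
    ∃ c : ℝ, 0 < c ∧
      ∀ K : Set (EuclideanSpace ℝ (Fin n)), MeasurableSet K → volume K < ⊤ →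
      ∀ a : EuclideanSpace ℝ (Fin n) → ℝ, Measurable a →
      ∀ E ε : ℝ, 0 < ε → ε < 1 →
      ∀ h ∈ Set.Ioc (0:ℝ) 1,
        (∫ v in K, (1 + |a v - E| / (C * h)) ^ (-(N:ℝ))) ≤
          c * (h ^ ((N:ℝ) * ε) * (volume K).toReal +
            (⨆ E' ∈ Set.Icc (E - h ^ (1 - ε)) (E + h ^ (1 - ε)),
              volume {v ∈ K | |a v - E'| ≤ C * h}).toReal) := by
  have hsum : Summable (fun k : ℕ => 1 / ((k : ℝ) + 1) ^ 2) := by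
    have := (summable_nat_add_iff 1).2 (Real.summable_one_div_nat_pow.2 (by norm_num : 1 < 2))
    simpa using this
  set c0 : ℝ := ∑' k : ℕ, 1 / ((k : ℝ) + 1) ^ 2 with hc0
  have hc0n : 0 ≤ c0 := tsum_nonneg fun k => by positivity
  have hCp : 0 < C := by linarith
  refine ⟨C ^ N + 2 * c0, by positivity, ?_⟩
  intro K hK hKf a ha E ε hε hε1 h hh
  obtain ⟨h0, h1⟩ := hh
  set δ : ℝ := h ^ (1 - ε) with hδ
  have hδ0 : 0 < δ := Real.rpow_pos_of_pos h0 _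
  set w : ℝ := C * h with hw
  have hw0 : 0 < w := by positivity
  set T : ENNReal := ⨆ E' ∈ Set.Icc (E - δ) (E + δ), volume {v ∈ K | |a v - E'| ≤ w} with hT
  have hTtop : T ≠ ⊤ := by
    refine ne_top_of_le_ne_top hKf.ne ?_
    exact iSup₂_le fun E' _ => measure_mono fun v hv => hv.1
  set μ := (volume : Measure (EuclideanSpace ℝ (Fin n))).restrict K with hμ
  have : IsFiniteMeasure μ := ⟨by simpa [hμ] using hKf⟩
  let P : ℝ → Set (EuclideanSpace ℝ (Fin n)) := fun x => {v | |a v - x| ≤ w}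
  have hP : ∀ x, MeasurableSet (P x) := fun x =>
    measurableSet_le (by fun_prop) measurable_const
  have hPS : ∀ x ∈ Set.Icc (E - δ) (E + δ), μ.real (P x) ≤ T.toReal := by
    intro x hx
    refine ENNReal.toReal_mono hTtop ?_
    rw [hμ, Measure.restrict_apply (hP x)]
    have e : P x ∩ K = {v ∈ K | |a v - x| ≤ w} := by
      ext v; simp [P, and_comm]
    rw [e]
    exact le_iSup₂ (f := fun E' (_ : E' ∈ Set.Icc (E - δ) (E + δ)) =>
      volume {v ∈ K | |a v - E'| ≤ w}) x hx
  set M : ℕ := ⌊δ / w⌋₊ with hM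
  let q : ℝ := h ^ ((N:ℝ) * ε)
  have hq0 : 0 < q := Real.rpow_pos_of_pos h0 _
  let I : ℝ → EuclideanSpace ℝ (Fin n) → ℝ := fun x => (P x).indicator (fun _ => (1:ℝ))
  have hI0 : ∀ x v, 0 ≤ I x v := fun x v => Set.indicator_nonneg (fun _ _ => zero_le_one) v
  have hIint : ∀ x, Integrable (I x) μ := fun x => (integrable_const (1:ℝ)).indicator (hP x)
  have hIval : ∀ x, ∫ v, I x v ∂μ = μ.real (P x) := fun x => by
    simp only [I]
    rw [integral_indicator_const _ (hP x)]; simp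
  let g : EuclideanSpace ℝ (Fin n) → ℝ := fun v => C ^ N * q +
    ∑ k ∈ Finset.range (M + 1), 1 / ((k : ℝ) + 1) ^ 2 * (I (E + k * w) v + I (E - k * w) v)
  have hsint : ∀ k ∈ Finset.range (M + 1), Integrable (fun v =>
      1 / ((k : ℝ) + 1) ^ 2 * (I (E + k * w) v + I (E - k * w) v)) μ := fun k _ =>
    ((hIint _).add (hIint _)).const_mul _
  have hgint : Integrable g μ :=
    (integrable_const _).add (integrable_finset_sum _ hsint)
  have hfg : ∀ v, (1 + |a v - E| / w) ^ (-(N:ℝ)) ≤ g v := by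
    intro v
    have ht0 : 0 ≤ |a v - E| / w := by positivity
    set t := |a v - E| / w with ht
    rw [Real.rpow_neg (by positivity), Real.rpow_natCast]
    have hs0 : ∀ k ∈ Finset.range (M + 1), 0 ≤
      1 / ((k : ℝ) + 1) ^ 2 * (I (E + k * w) v + I (E - k * w) v) := fun k _ =>
        mul_nonneg (by positivity) (add_nonneg (hI0 _ _) (hI0 _ _))
    by_cases hc : |a v - E| ≤ δ
    · have htM : ⌊t⌋₊ ∈ Finset.range (M + 1) := by
        rw [Finset.mem_range, Nat.lt_succ_iff]
        exact Nat.floor_mono (by rw [ht]; gcongr)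
      have hle := Finset.single_le_sum hs0 htM
      have hk1 : (⌊t⌋₊ : ℝ) ≤ t := Nat.floor_le ht0
      have hk2 : t < ⌊t⌋₊ + 1 := Nat.lt_floor_add_one t
      have htw : t * w = |a v - E| := by rw [ht]; field_simp
      have hmem : 1 ≤ I (E + ⌊t⌋₊ * w) v + I (E - ⌊t⌋₊ * w) v := by
        have k1 : (⌊t⌋₊ : ℝ) * w ≤ t * w := by gcongr
        have k2 : t * w ≤ (⌊t⌋₊ + 1) * w := by gcongr
        rcases le_total 0 (a v - E) with hs | hs
        · rw [abs_of_nonneg hs] at htw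
          have : v ∈ P (E + ⌊t⌋₊ * w) := by
            show |_| ≤ w
            rw [abs_le]; constructor <;> linarith
          have h1 : I (E + ⌊t⌋₊ * w) v = 1 := Set.indicator_of_mem this _
          linarith [hI0 (E - ⌊t⌋₊ * w) v]
        · rw [abs_of_nonpos hs] at htw
          have : v ∈ P (E - ⌊t⌋₊ * w) := by
            show |_| ≤ w
            rw [abs_le]; constructor <;> linarith
          have h1 : I (E - ⌊t⌋₊ * w) v = 1 := Set.indicator_of_mem this _
          linarith [hI0 (E + ⌊t⌋₊ * w) v]
      have hb : ((1 + t) ^ N)⁻¹ ≤ 1 / ((⌊t⌋₊ : ℝ) + 1) ^ 2 := by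
        rw [one_div]
        apply inv_anti₀ (by positivity)
        calc ((⌊t⌋₊ : ℝ) + 1) ^ 2 ≤ (1 + t) ^ 2 := by gcongr ?_ ^ 2; linarith
          _ ≤ (1 + t) ^ N := pow_le_pow_right₀ (by linarith) hN
      have hb2 := le_mul_of_one_le_right
        (by positivity : 0 ≤ 1 / ((⌊t⌋₊ : ℝ) + 1) ^ 2) hmem
      have : 0 ≤ C ^ N * q := by positivity
      simp only [g]
      linarith
    · push Not at hc
      have hsn := Finset.sum_nonneg hs0
      have hb : ((1 + t) ^ N)⁻¹ ≤ C ^ N * q := by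
        have hqe : q = (h ^ ε) ^ N := by
          simp only [q]
          rw [mul_comm, Real.rpow_mul h0.le, Real.rpow_natCast]
        rw [hqe, ← mul_pow, ← inv_pow]
        have hp : 0 < h ^ ε := Real.rpow_pos_of_pos h0 _
        have hde : δ * h ^ ε = h := by
          rw [hδ, ← Real.rpow_add h0]; simp
        gcongr
        rw [inv_le_comm₀ (by positivity) (by positivity)]
        have : (C * h ^ ε)⁻¹ = δ / w := by
          rw [hw]
          field_simp
          linarith
        rw [this]
        have : δ / w ≤ t := by rw [ht]; gcongr
        linarith
      simp only [g]
      linarith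
  have hmono : ∫ v, (1 + |a v - E| / w) ^ (-(N:ℝ)) ∂μ ≤ ∫ v, g v ∂μ :=
    integral_mono_of_nonneg (Filter.Eventually.of_forall fun v => by positivity) hgint
      (Filter.Eventually.of_forall hfg)
  have hgval : ∫ v, g v ∂μ ≤ C ^ N * q * (volume K).toReal + 2 * c0 * T.toReal := by
    simp only [g]
    rw [integral_add (integrable_const _) (integrable_finset_sum _ hsint),
      integral_finset_sum _ hsint, integral_const]
    have e1 : μ.real Set.univ = (volume K).toReal := by simp [hμ, Measure.real]
    rw [e1, smul_eq_mul, mul_comm]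
    gcongr
    calc _ ≤ ∑ k ∈ Finset.range (M + 1), 1 / ((k : ℝ) + 1) ^ 2 * (2 * T.toReal) := by
          refine Finset.sum_le_sum fun k hk => ?_
          rw [integral_const_mul, integral_add (hIint _) (hIint _), hIval, hIval]
          have hkM : (k : ℝ) * w ≤ δ := by
            rw [← le_div_iff₀ hw0]
            rw [Finset.mem_range, Nat.lt_succ_iff] at hk
            exact (Nat.cast_le.2 hk).trans (Nat.floor_le (by positivity))
          have hk0 : 0 ≤ (k : ℝ) * w := by positivity
          have i1 := hPS (E + k * w) ⟨by linarith, by linarith⟩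
          have i2 := hPS (E - k * w) ⟨by linarith, by linarith⟩
          gcongr
          linarith
      _ = (∑ k ∈ Finset.range (M + 1), 1 / ((k : ℝ) + 1) ^ 2) * (2 * T.toReal) := by
          rw [Finset.sum_mul]
      _ ≤ c0 * (2 * T.toReal) := by
          gcongr
          exact hsum.sum_le_tsum _ fun k _ => by positivity
      _ = _ := by ring
  have hfin := hmono.trans hgval
  have hV : 0 ≤ (volume K).toReal := ENNReal.toReal_nonneg
  have hT0 : 0 ≤ T.toReal := ENNReal.toReal_nonneg
  have x1 : 0 ≤ C ^ N * T.toReal := by positivity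
  have x2 : 0 ≤ 2 * c0 * (q * (volume K).toReal) := by positivity
  change _ ≤ (C ^ N + 2 * c0) * (q * (volume K).toReal + T.toReal)
  linarith
end
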